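/- arXiv:math/0004137 — 2 statements merged into one kernel-verified Lean document; each statement's English description precedes it below -/
import Mathlib

section
/- (Expansion of skew stable Grothendieck polynomials) For partitions λ ⊆ ν and every m ≥ 1, the identity G_{ν/λ}(x_1,…,x_m) = Σ_μ α_{ν/λ,μ}·G_μ(x_1,…,x_m) holds in ℤ[x_1,…,x_m], where the sum is over all partitions μ (only finitely many terms being nonzero) and α_{ν/λ,μ} is (−1)^{|μ|−|ν/λ|} times the number of set-valued tableaux T of shape ν/λ, with entries arbitrary positive integers, such that w(T) is a reverse lattice word with content μ. -/
open MvPolynomial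

/-- A set-valued tableau on an arbitrary finite set of boxes `(row, column)`.
Entries are `0`-based: the entry `i : ℕ` stands for the integer `i + 1`
(equivalently, for the variable `x_{i+1}`).  Rows weakly increase from left to
right and columns strictly increase from top to bottom, expressed via
horizontally and vertically adjacent boxes. -/
structure SVT (cells : Finset (ℕ × ℕ)) where
  entry : ℕ × ℕ → Finset ℕ
  nonempty_of_mem : ∀ c ∈ cells, (entry c).Nonempty
  eq_empty_of_not_mem : ∀ c, c ∉ cells → entry c = ∅
  row_weak : ∀ i j, (i, j) ∈ cells → (i, j + 1) ∈ cells →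
    ∀ a ∈ entry (i, j), ∀ b ∈ entry (i, j + 1), a ≤ b
  col_strict : ∀ i j, (i, j) ∈ cells → (i + 1, j) ∈ cells →
    ∀ a ∈ entry (i, j), ∀ b ∈ entry (i + 1, j), a < b

namespace SVT

variable {cells : Finset (ℕ × ℕ)}

/-- `|T|`: the total number of integers in the boxes of `T`. -/
def size (T : SVT cells) : ℕ := ∑ c ∈ cells, (T.entry c).card

/-- `T` has all its entries among `{1, …, m}` (i.e. `0`-based entries `< m`). -/
def Bounded (T : SVT cells) (m : ℕ) : Prop := ∀ c, ∀ x ∈ T.entry c, x < m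

/-- The monomial `x^T`, where the exponent of the variable `i` is the number of
boxes of `T` containing `i`. -/
noncomputable def monomial (T : SVT cells) : MvPolynomial ℕ ℤ :=
  ∏ c ∈ cells, ∏ i ∈ T.entry c, X i

/-- The column word of `T`: columns are read from left to right, each column
from bottom to top, the integers within a box in increasing order. -/
def word (T : SVT cells) : List ℕ :=
  (List.range ((cells.sup fun c => max c.1 c.2) + 1)).flatMap fun j =>
    ((List.range ((cells.sup fun c => max c.1 c.2) + 1)).reverse).flatMap fun i =>
      (T.entry (i, j)).sort (· ≤ ·)

end SVT

/-- The stable Grothendieck polynomial of the shape given by `cells`, in the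
variables `x_1, …, x_m` (`0`-based: variables `0, …, m-1`):
`G(cells) = ∑_T (-1)^(|T| - #cells) x^T` over set-valued tableaux `T` of shape
`cells` with entries in `{1, …, m}`. -/
noncomputable def grothendieck (cells : Finset (ℕ × ℕ)) (m : ℕ) : MvPolynomial ℕ ℤ :=
  ∑ᶠ (T : SVT cells) (_ : T.Bounded m), ((-1 : ℤ) ^ (T.size - cells.card)) • T.monomial

/-- A reverse lattice word: every suffix contains, for each `i`, at least as
many occurrences of `i` as of `i + 1`. -/
def IsRLW (w : List ℕ) : Prop := ∀ s, s <:+ w → ∀ i, s.count (i + 1) ≤ s.count i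

/-- A partial reverse lattice word with respect to the (`0`-based, half-open)
interval `[a, b)`:  every suffix contains, for each `t` with `a ≤ t` and
`t + 1 < b`, at least as many occurrences of `t` as of `t + 1`. -/
def IsPartialRLW (a b : ℕ) (w : List ℕ) : Prop :=
  ∀ s, s <:+ w → ∀ t, a ≤ t → t + 1 < b → s.count (t + 1) ≤ s.count t

/-- `w` has content `ν`: the number of occurrences of `i` in `w` is the length
of the `i`-th row of `ν`. -/
def HasContent (w : List ℕ) (nu : YoungDiagram) : Prop := ∀ i, w.count i = nu.rowLen i

/-- The cells of the skew diagram `λ * μ`, obtained by placing `λ` and `μ`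
corner to corner: `λ` occupies rows `0, …, ℓ(λ)-1` shifted right by `μ₁`
columns, and `μ` occupies the rows below row `ℓ(λ)-1`. -/
def starCells (lam mu : YoungDiagram) : Finset (ℕ × ℕ) :=
  (lam.cells.image fun c => (c.1, c.2 + mu.rowLen 0)) ∪
    (mu.cells.image fun c => (c.1 + lam.colLen 0, c.2))

/-- The structure constant `c^ν_{λμ}`: `(-1)^(|ν|-|λ|-|μ|)` times the number of
set-valued tableaux of shape `λ * μ` whose word is a reverse lattice word with
content `ν`. -/
noncomputable def cLR (lam mu nu : YoungDiagram) : ℤ :=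
  (-1 : ℤ) ^ (nu.card - lam.card - mu.card) *
    (Nat.card {T : SVT (starCells lam mu) // IsRLW T.word ∧ HasContent T.word nu} : ℤ)

/-- The coproduct structure constant `d^ν_{λμ}`: `(-1)^(|λ|+|μ|-|ν|)` times the
number of set-valued tableaux of shape `ν` whose word is a partial reverse
lattice word with respect to both intervals `[1, ℓ(λ)]` and
`[ℓ(λ)+1, ℓ(λ)+ℓ(μ)]` and has content `(λ₁, …, λ_{ℓ(λ)}, μ₁, …, μ_{ℓ(μ)})`. -/
noncomputable def dCoeff (lam mu nu : YoungDiagram) : ℤ :=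
  (-1 : ℤ) ^ (lam.card + mu.card - nu.card) *
    (Nat.card {T : SVT nu.cells //
      IsPartialRLW 0 (lam.colLen 0) T.word ∧
      IsPartialRLW (lam.colLen 0) (lam.colLen 0 + mu.colLen 0) T.word ∧
      ∀ i, T.word.count i =
        if i < lam.colLen 0 then lam.rowLen i else mu.rowLen (i - lam.colLen 0)} : ℤ)

/-- The coefficient `α_{θ,μ}` for a shape `θ` given by `cells`:
`(-1)^(|μ|-|θ|)` times the number of set-valued tableaux of shape `θ` whose
word is a reverse lattice word with content `μ`. -/
noncomputable def alphaCoeff (cells : Finset (ℕ × ℕ)) (mu : YoungDiagram) : ℤ :=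
  (-1 : ℤ) ^ (mu.card - cells.card) *
    (Nat.card {T : SVT cells // IsRLW T.word ∧ HasContent T.word mu} : ℤ)

/-- `ν/λ` is a vertical strip: at most one box in each row. -/
def IsVerticalStrip (lam nu : YoungDiagram) : Prop := ∀ i, nu.rowLen i ≤ lam.rowLen i + 1

/-- `ν/λ` is a horizontal strip: at most one box in each column. -/
def IsHorizontalStrip (lam nu : YoungDiagram) : Prop := ∀ j, nu.colLen j ≤ lam.colLen j + 1

/-- A set of boxes is a rook strip if it has at most one box in each row and in
each column. -/
def IsRookStripCells (s : Finset (ℕ × ℕ)) : Prop :=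
  (∀ i, (s.filter fun c => c.1 = i).card ≤ 1) ∧ (∀ j, (s.filter fun c => c.2 = j).card ≤ 1)

/-- The rectangular Young diagram with `p` rows and `q` columns. -/
def rect (p q : ℕ) : YoungDiagram :=
  ⟨Finset.range p ×ˢ Finset.range q, by
    intro a b hba ha
    simp only [Finset.coe_product, Set.mem_prod, Finset.mem_coe, Finset.mem_range] at ha ⊢
    exact ⟨lt_of_le_of_lt hba.1 ha.1, lt_of_le_of_lt hba.2 ha.2⟩⟩

namespace SVT

variable {S : Finset (ℕ × ℕ)}

@[ext]
theorem ext_entry {T U : SVT S} (h : ∀ c, T.entry c = U.entry c) : T = U := by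
  obtain ⟨f, _, _, _, _⟩ := T
  obtain ⟨g, _, _, _, _⟩ := U
  obtain rfl : f = g := funext h
  rfl

theorem mem_cells (T : SVT S) {c : ℕ × ℕ} {a : ℕ} (ha : a ∈ T.entry c) : c ∈ S := by
  by_contra hc
  simp [T.eq_empty_of_not_mem c hc] at ha

theorem mem_of_between (hS : (S : Set (ℕ × ℕ)).OrdConnected) {r j r' j' p q : ℕ}
    (h : (r, j) ∈ S) (h' : (r', j') ∈ S) (hp : r ≤ p) (hp' : p ≤ r') (hq : j ≤ q)
    (hq' : q ≤ j') : (p, q) ∈ S := by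
  have := hS.out (Finset.mem_coe.2 h) (Finset.mem_coe.2 h')
    (show (p, q) ∈ Set.Icc (r, j) (r', j') from ⟨⟨hp, hq⟩, ⟨hp', hq'⟩⟩)
  exact_mod_cast this

/-- Entries weakly increase along rows, also between boxes that are not adjacent. -/
theorem row_le (hS : (S : Set (ℕ × ℕ)).OrdConnected) (T : SVT S) {r j j' a b : ℕ}
    (ha : a ∈ T.entry (r, j)) (hb : b ∈ T.entry (r, j')) (h : j < j') : a ≤ b := by
  induction j', h using Nat.le_induction generalizing b with
  | base => exact T.row_weak r j (T.mem_cells ha) (T.mem_cells hb) a ha b hb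
  | succ k hk ih =>
    have hc : (r, k) ∈ S :=
      mem_of_between hS (T.mem_cells ha) (T.mem_cells hb) le_rfl le_rfl (by omega) (by omega)
    obtain ⟨x, hx⟩ := T.nonempty_of_mem _ hc
    exact (ih hx).trans (T.row_weak r k hc (T.mem_cells hb) x hx b hb)

/-- Entries strictly increase along columns, also between boxes that are not adjacent. -/
theorem col_lt (hS : (S : Set (ℕ × ℕ)).OrdConnected) (T : SVT S) {r r' j a b : ℕ}
    (ha : a ∈ T.entry (r, j)) (hb : b ∈ T.entry (r', j)) (h : r < r') : a < b := by
  induction r', h using Nat.le_induction generalizing b with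
  | base => exact T.col_strict r j (T.mem_cells ha) (T.mem_cells hb) a ha b hb
  | succ k hk ih =>
    have hc : (k, j) ∈ S :=
      mem_of_between hS (T.mem_cells ha) (T.mem_cells hb) (by omega) (by omega) le_rfl le_rfl
    obtain ⟨x, hx⟩ := T.nonempty_of_mem _ hc
    exact (ih hx).trans (T.col_strict k j hc (T.mem_cells hb) x hx b hb)

/-- A box is active for `i` if it contains `i` or `i + 1`. -/
def Active (T : SVT S) (i : ℕ) (c : ℕ × ℕ) : Prop := i ∈ T.entry c ∨ i + 1 ∈ T.entry c

/-- A box is free for `i` if it is active and neither of its vertical neighbours is. -/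
def Free (T : SVT S) (i : ℕ) (c : ℕ × ℕ) : Prop :=
  T.Active i c ∧ ¬ T.Active i (c.1 + 1, c.2) ∧ ∀ r, r + 1 = c.1 → ¬ T.Active i (r, c.2)

theorem Active.mem {T : SVT S} {i : ℕ} {c : ℕ × ℕ} (h : T.Active i c) : c ∈ S :=
  h.elim T.mem_cells T.mem_cells

/-- In a vertical pair of active boxes, the upper one contains `i` and the lower one `i + 1`. -/
theorem Active.pair {T : SVT S} {i r j : ℕ} (h : T.Active i (r, j)) (h' : T.Active i (r + 1, j)) :
    i ∈ T.entry (r, j) ∧ i + 1 ∉ T.entry (r, j) ∧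
      i ∉ T.entry (r + 1, j) ∧ i + 1 ∈ T.entry (r + 1, j) := by
  have key := T.col_strict r j h.mem h'.mem
  have h1 : i + 1 ∉ T.entry (r, j) := fun h1 => by
    rcases h' with h' | h' <;> have := key _ h1 _ h' <;> omega
  have h2 : i ∉ T.entry (r + 1, j) := fun h2 => by
    rcases h with h | h <;> have := key _ h _ h2 <;> omega
  exact ⟨h.resolve_right h1, h1, h2, h'.resolve_left h2⟩

/-- Free boxes of a row form an interval. -/
theorem Free.of_between (hS : (S : Set (ℕ × ℕ)).OrdConnected) {T : SVT S} {i r j j' k : ℕ}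
    (h : T.Free i (r, j)) (h' : T.Free i (r, j')) (hk : j < k) (hk' : k < j') :
    T.Free i (r, k) := by
  have hc : (r, k) ∈ S :=
    mem_of_between hS h.1.mem h'.1.mem le_rfl le_rfl hk.le hk'.le
  have hact : ∀ x ∈ T.entry (r, k), i ≤ x ∧ x ≤ i + 1 := fun x hx => by
    constructor
    · rcases h.1 with h | h <;> have := T.row_le hS h hx hk <;> omega
    · rcases h'.1 with h | h <;> have := T.row_le hS hx h hk' <;> omega
  have ha : T.Active i (r, k) := by
    obtain ⟨x, hx⟩ := T.nonempty_of_mem _ hc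
    have := hact x hx
    obtain rfl | rfl : x = i ∨ x = i + 1 := by omega
    exacts [Or.inl hx, Or.inr hx]
  refine ⟨ha, fun hb => h.2.1 ?_, fun s hs hb => h'.2.2 s hs ?_⟩
  · obtain ⟨h1, -, -, h2⟩ := ha.pair hb
    have hd : (r + 1, j) ∈ S :=
      mem_of_between hS h.1.mem hb.mem (by omega) le_rfl le_rfl hk.le
    obtain ⟨x, hx⟩ := T.nonempty_of_mem _ hd
    have h3 := T.row_le hS hx h2 hk
    have h4 : i < x := by
      rcases h.1 with h | h
      · exact T.col_strict r j (T.mem_cells h) hd _ h _ hx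
      · have := T.row_le hS h h1 hk
        omega
    obtain rfl : x = i + 1 := by omega
    exact Or.inr hx
  · obtain rfl : s + 1 = r := hs
    obtain ⟨h1, -, -, h2⟩ := Active.pair hb ha
    have hd : (s, j') ∈ S :=
      mem_of_between hS hb.mem h'.1.mem le_rfl (by omega) hk'.le le_rfl
    obtain ⟨x, hx⟩ := T.nonempty_of_mem _ hd
    have h3 := T.row_le hS h1 hx hk'
    have h4 : x < i + 1 := by
      rcases h'.1 with h | h
      · have := T.row_le hS h2 h hk'
        omega
      · exact T.col_strict s j' hd (T.mem_cells h) _ hx _ h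
    obtain rfl : x = i := by omega
    exact Or.inl hx

end SVT

/-- The reflection of an interval of natural numbers. -/
def Finset.reflect (F : Finset ℕ) (j : ℕ) : ℕ :=
  if h : F.Nonempty then F.min' h + F.max' h - j else j

theorem Finset.reflect_mem {F : Finset ℕ}
    (hF : ∀ a ∈ F, ∀ b ∈ F, ∀ k, a < k → k < b → k ∈ F) {j : ℕ} (hj : j ∈ F) :
    F.reflect j ∈ F := by
  have h : F.Nonempty := ⟨j, hj⟩
  have h1 := F.min'_le j hj
  have h2 := F.le_max' j hj
  simp only [Finset.reflect, dif_pos h]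
  generalize hk : F.min' h + F.max' h - j = k
  rcases (show F.min' h ≤ k by omega).eq_or_lt with h3 | h3
  · exact h3 ▸ F.min'_mem h
  rcases (show k ≤ F.max' h by omega).eq_or_lt with h4 | h4
  · exact h4 ▸ F.max'_mem h
  exact hF _ (F.min'_mem h) _ (F.max'_mem h) _ h3 h4

theorem Finset.reflect_reflect {F : Finset ℕ} {j : ℕ} (hj : j ∈ F) :
    F.reflect (F.reflect j) = j := by
  have h : F.Nonempty := ⟨j, hj⟩
  have h1 := F.min'_le j hj
  have h2 := F.le_max' j hj
  simp only [Finset.reflect, dif_pos h]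
  omega

theorem Finset.reflect_succ {F : Finset ℕ} {j : ℕ} (hj : j + 1 ∈ F) :
    F.reflect j = F.reflect (j + 1) + 1 := by
  have h : F.Nonempty := ⟨_, hj⟩
  have h1 := F.min'_le _ hj
  have h2 := F.le_max' _ hj
  simp only [Finset.reflect, dif_pos h]
  omega

namespace SVT

variable {S : Finset (ℕ × ℕ)}

open Classical in
/-- The columns before `k` in which row `r` has a free box. -/
noncomputable def freeCols (T : SVT S) (i k r : ℕ) : Finset ℕ :=
  (Finset.range k).filter fun j => T.Free i (r, j)

theorem mem_freeCols {T : SVT S} {i k r j : ℕ} :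
    j ∈ T.freeCols i k r ↔ j < k ∧ T.Free i (r, j) := by
  simp [freeCols]

theorem reflect_mem_freeCols (hS : (S : Set (ℕ × ℕ)).OrdConnected) {T : SVT S} {i k r j : ℕ}
    (h : j ∈ T.freeCols i k r) : (T.freeCols i k r).reflect j ∈ T.freeCols i k r := by
  refine Finset.reflect_mem (fun a ha b hb l hl hl' => ?_) h
  rw [mem_freeCols] at *
  exact ⟨hl'.trans hb.1, ha.2.of_between hS hb.2 hl hl'⟩

open Classical in
/-- The entries obtained by reflecting, in each row, the free boxes in columns before `k`
and interchanging `i` and `i + 1` in them. -/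
noncomputable def swapEntry (T : SVT S) (i k : ℕ) (c : ℕ × ℕ) : Finset ℕ :=
  if c.2 ∈ T.freeCols i k c.1 then
    ((T.entry c).filter fun y => y ≠ i ∧ y ≠ i + 1) ∪
      ((T.entry (c.1, (T.freeCols i k c.1).reflect c.2)).filter
        fun y => y = i ∨ y = i + 1).image (Equiv.swap i (i + 1))
  else T.entry c

theorem swapEntry_of_not_mem {T : SVT S} {i k r j : ℕ} (h : j ∉ T.freeCols i k r) :
    T.swapEntry i k (r, j) = T.entry (r, j) := if_neg h

theorem mem_swapEntry_of_ne {T : SVT S} {i k : ℕ} {c : ℕ × ℕ} {y : ℕ} (h : y ≠ i)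
    (h' : y ≠ i + 1) : y ∈ T.swapEntry i k c ↔ y ∈ T.entry c := by
  unfold swapEntry
  split_ifs
  · simp only [Finset.mem_union, Finset.mem_filter, Finset.mem_image]
    constructor
    · rintro (h1 | ⟨z, ⟨-, rfl | rfl⟩, rfl⟩)
      · exact h1.1
      · simp at h'
      · simp at h
    · exact fun h1 => Or.inl ⟨h1, h, h'⟩
  · rfl

theorem left_mem_swapEntry {T : SVT S} {i k r j : ℕ} (h : j ∈ T.freeCols i k r) :
    i ∈ T.swapEntry i k (r, j) ↔ i + 1 ∈ T.entry (r, (T.freeCols i k r).reflect j) := by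
  rw [swapEntry, if_pos h]
  simp only [Finset.mem_union, Finset.mem_filter, Finset.mem_image]
  constructor
  · rintro (h1 | ⟨z, ⟨h1, rfl | rfl⟩, h2⟩)
    · simp at h1
    · simp at h2
    · exact h1
  · exact fun h1 => Or.inr ⟨i + 1, ⟨h1, Or.inr rfl⟩, by simp⟩

theorem right_mem_swapEntry {T : SVT S} {i k r j : ℕ} (h : j ∈ T.freeCols i k r) :
    i + 1 ∈ T.swapEntry i k (r, j) ↔ i ∈ T.entry (r, (T.freeCols i k r).reflect j) := by
  rw [swapEntry, if_pos h]
  simp only [Finset.mem_union, Finset.mem_filter, Finset.mem_image]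
  constructor
  · rintro (h1 | ⟨z, ⟨h1, rfl | rfl⟩, h2⟩)
    · simp at h1
    · exact h1
    · simp at h2
  · exact fun h1 => Or.inr ⟨i, ⟨h1, Or.inl rfl⟩, by simp⟩

theorem active_swapEntry (hS : (S : Set (ℕ × ℕ)).OrdConnected) {T : SVT S} {i k : ℕ}
    {c : ℕ × ℕ} :
    (i ∈ T.swapEntry i k c ∨ i + 1 ∈ T.swapEntry i k c) ↔ T.Active i c := by
  obtain ⟨r, j⟩ := c
  by_cases h : j ∈ T.freeCols i k r
  · rw [left_mem_swapEntry h, right_mem_swapEntry h, or_comm]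
    have h1 := (mem_freeCols.1 (reflect_mem_freeCols hS h)).2
    have h2 := (mem_freeCols.1 h).2
    exact iff_of_true h1.1 h2.1
  · rw [swapEntry_of_not_mem h]
    rfl

theorem swap_row_weak (hS : (S : Set (ℕ × ℕ)).OrdConnected) (T : SVT S) {i k : ℕ}
    (hk : ∀ r, i ∉ T.entry (r, k)) (r j a b : ℕ) (ha : a ∈ T.swapEntry i k (r, j))
    (hb : b ∈ T.swapEntry i k (r, j + 1)) : a ≤ b := by
  have row : ∀ {a b}, a ∈ T.entry (r, j) → b ∈ T.entry (r, j + 1) → a ≤ b :=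
    fun ha hb => T.row_weak r j (T.mem_cells ha) (T.mem_cells hb) _ ha _ hb
  by_cases ha' : a = i ∨ a = i + 1
  · have hA : T.Active i (r, j) := (active_swapEntry hS).1 (by
      rcases ha' with rfl | rfl
      exacts [Or.inl ha, Or.inr ha])
    by_cases hb' : b = i ∨ b = i + 1
    · have hB : T.Active i (r, j + 1) := (active_swapEntry hS).1 (by
        rcases hb' with rfl | rfl
        exacts [Or.inl hb, Or.inr hb])
      by_contra hlt
      obtain ⟨rfl, rfl⟩ : a = i + 1 ∧ b = i := by omega
      by_cases h1 : j ∈ T.freeCols b k r <;> by_cases h2 : j + 1 ∈ T.freeCols b k r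
      · rw [right_mem_swapEntry h1, Finset.reflect_succ h2] at ha
        rw [left_mem_swapEntry h2] at hb
        have := T.row_le hS hb ha (Nat.lt_succ_self _)
        omega
      · rw [swapEntry_of_not_mem h2] at hb
        rw [mem_freeCols] at h1 h2
        have hjk : j + 1 < k := by
          rcases (show j + 1 ≤ k from h1.1).eq_or_lt with h | h
          · exact absurd (h ▸ hb) (hk r)
          · exact h
        refine h2 ⟨hjk, hB, fun hd => h1.2.2.1 ?_, fun s hs hd => ?_⟩
        · obtain ⟨-, -, -, h3⟩ := hB.pair hd
          have hm : (r + 1, j) ∈ S :=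
            mem_of_between hS hA.mem hd.mem (by omega) le_rfl le_rfl (by simp)
          obtain ⟨x, hx⟩ := T.nonempty_of_mem _ hm
          have h4 := T.row_le hS hx h3 (Nat.lt_succ_self _)
          have h5 : b < x := by
            rcases hA with h | h
            · exact T.col_strict r j (T.mem_cells h) hm _ h _ hx
            · have := row h hb
              omega
          obtain rfl : x = b + 1 := by omega
          exact Or.inr hx
        · obtain rfl : s + 1 = r := hs
          exact (Active.pair hd hB).2.2.1 hb
      · rw [swapEntry_of_not_mem h1] at ha
        rw [mem_freeCols] at h1 h2
        refine h1 ⟨by omega, hA, fun hd => ?_, fun s hs hd => h2.2.2.2 s hs ?_⟩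
        · exact (Active.pair hA hd).2.1 ha
        · obtain rfl : s + 1 = r := hs
          obtain ⟨h3, -, -, -⟩ := Active.pair hd hA
          have hm : (s, j + 1) ∈ S :=
            mem_of_between hS hd.mem hB.mem le_rfl (by omega) (by simp) le_rfl
          obtain ⟨x, hx⟩ := T.nonempty_of_mem _ hm
          have h4 := T.row_le hS h3 hx (Nat.lt_succ_self _)
          have h5 : x < b + 1 := by
            rcases hB with h | h
            · have := row ha h
              omega
            · exact T.col_strict s (j + 1) hm (T.mem_cells h) _ hx _ h
          obtain rfl : x = b := by omega
          exact Or.inl hx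
      · rw [swapEntry_of_not_mem h1] at ha
        rw [swapEntry_of_not_mem h2] at hb
        have := row ha hb
        omega
    · rw [mem_swapEntry_of_ne (by omega) (by omega)] at hb
      rcases hA with h | h <;> have := row h hb <;> omega
  · rw [mem_swapEntry_of_ne (by omega) (by omega)] at ha
    by_cases hb' : b = i ∨ b = i + 1
    · have hB : T.Active i (r, j + 1) := (active_swapEntry hS).1 (by
        rcases hb' with rfl | rfl
        exacts [Or.inl hb, Or.inr hb])
      rcases hB with h | h <;> have := row ha h <;> omega
    · rw [mem_swapEntry_of_ne (by omega) (by omega)] at hb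
      exact row ha hb

theorem swap_col_strict (hS : (S : Set (ℕ × ℕ)).OrdConnected) (T : SVT S) {i k : ℕ}
    (r j a b : ℕ) (ha : a ∈ T.swapEntry i k (r, j))
    (hb : b ∈ T.swapEntry i k (r + 1, j)) : a < b := by
  have col : ∀ {a b}, a ∈ T.entry (r, j) → b ∈ T.entry (r + 1, j) → a < b :=
    fun ha hb => T.col_strict r j (T.mem_cells ha) (T.mem_cells hb) _ ha _ hb
  by_cases ha' : a = i ∨ a = i + 1
  · have hA : T.Active i (r, j) := (active_swapEntry hS).1 (by
      rcases ha' with rfl | rfl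
      exacts [Or.inl ha, Or.inr ha])
    by_cases hb' : b = i ∨ b = i + 1
    · have hB : T.Active i (r + 1, j) := (active_swapEntry hS).1 (by
        rcases hb' with rfl | rfl
        exacts [Or.inl hb, Or.inr hb])
      rw [swapEntry_of_not_mem fun h => (mem_freeCols.1 h).2.2.1 hB] at ha
      rw [swapEntry_of_not_mem fun h => (mem_freeCols.1 h).2.2.2 r rfl hA] at hb
      exact col ha hb
    · rw [mem_swapEntry_of_ne (by omega) (by omega)] at hb
      have hB : ¬ (b = i ∨ b = i + 1) := hb'
      rcases hA with h | h <;> have := col h hb <;> omega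
  · rw [mem_swapEntry_of_ne (by omega) (by omega)] at ha
    by_cases hb' : b = i ∨ b = i + 1
    · have hB : T.Active i (r + 1, j) := (active_swapEntry hS).1 (by
        rcases hb' with rfl | rfl
        exacts [Or.inl hb, Or.inr hb])
      rcases hB with h | h <;> have := col ha h <;> omega
    · rw [mem_swapEntry_of_ne (by omega) (by omega)] at hb
      exact col ha hb

/-- The Bender–Knuth type involution for the letters `i` and `i + 1`, restricted to the columns
before a column `k` that does not contain `i`. -/
noncomputable def swap (hS : (S : Set (ℕ × ℕ)).OrdConnected) (T : SVT S) (i k : ℕ)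
    (hk : ∀ r, i ∉ T.entry (r, k)) : SVT S where
  entry := T.swapEntry i k
  nonempty_of_mem c hc := by
    obtain ⟨x, hx⟩ := T.nonempty_of_mem c hc
    by_cases h : x = i ∨ x = i + 1
    · have : T.Active i c := by
        rcases h with rfl | rfl
        exacts [Or.inl hx, Or.inr hx]
      rcases (active_swapEntry hS).2 this with h | h
      exacts [⟨_, h⟩, ⟨_, h⟩]
    · exact ⟨x, (mem_swapEntry_of_ne (by omega) (by omega)).2 hx⟩
  eq_empty_of_not_mem := by
    rintro ⟨r, j⟩ hc
    rw [swapEntry_of_not_mem, T.eq_empty_of_not_mem (r, j) hc]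
    exact fun h => hc (mem_freeCols.1 h).2.1.mem
  row_weak i' j _ _ a ha b hb := T.swap_row_weak hS hk i' j a b ha hb
  col_strict i' j _ _ a ha b hb := T.swap_col_strict hS i' j a b ha hb

section swap

variable (hS : (S : Set (ℕ × ℕ)).OrdConnected) (T : SVT S) {i k : ℕ}
  (hk : ∀ r, i ∉ T.entry (r, k))

theorem swap_entry (c : ℕ × ℕ) : (T.swap hS i k hk).entry c = T.swapEntry i k c := rfl

theorem swap_entry_of_le {r j : ℕ} (hj : k ≤ j) :
    (T.swap hS i k hk).entry (r, j) = T.entry (r, j) :=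
  swapEntry_of_not_mem fun h => by
    have := (mem_freeCols.1 h).1
    omega

theorem free_swap (c : ℕ × ℕ) : (T.swap hS i k hk).Free i c ↔ T.Free i c := by
  have : ∀ c, (T.swap hS i k hk).Active i c ↔ T.Active i c := fun c => active_swapEntry hS
  simp only [Free, this]

theorem freeCols_swap (r : ℕ) : (T.swap hS i k hk).freeCols i k r = T.freeCols i k r := by
  ext j
  simp only [mem_freeCols, free_swap]

theorem not_mem_swap (r : ℕ) : i ∉ (T.swap hS i k hk).entry (r, k) := by
  rw [swap_entry_of_le hS T hk le_rfl]
  exact hk r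

theorem swap_swap :
    (T.swap hS i k hk).swap hS i k (T.not_mem_swap hS hk) = T := by
  ext ⟨r, j⟩ y
  rw [swap_entry]
  by_cases h : j ∈ T.freeCols i k r
  · have h' : j ∈ (T.swap hS i k hk).freeCols i k r := by rwa [freeCols_swap]
    have h2 := reflect_mem_freeCols hS h
    by_cases hy : y = i
    · subst hy
      rw [left_mem_swapEntry h', freeCols_swap, swap_entry, right_mem_swapEntry h2,
        Finset.reflect_reflect h]
    by_cases hy' : y = i + 1
    · subst hy'
      rw [right_mem_swapEntry h', freeCols_swap, swap_entry, left_mem_swapEntry h2,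
        Finset.reflect_reflect h]
    rw [mem_swapEntry_of_ne hy hy', swap_entry, mem_swapEntry_of_ne hy hy']
  · rw [swapEntry_of_not_mem (by rwa [freeCols_swap]), swap_entry, swapEntry_of_not_mem h]

end swap

/-- The number of boxes containing `y`. -/
def num (T : SVT S) (y : ℕ) : ℕ := (S.filter fun c => y ∈ T.entry c).card

/-- The number of boxes in columns before `k` containing `y`. -/
def numLeft (T : SVT S) (k y : ℕ) : ℕ := (S.filter fun c => c.2 < k ∧ y ∈ T.entry c).card

/-- The number of boxes in columns from `k` on containing `y`. -/
def numRight (T : SVT S) (k y : ℕ) : ℕ := (S.filter fun c => k ≤ c.2 ∧ y ∈ T.entry c).card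

theorem num_eq_add (T : SVT S) (k y : ℕ) : T.num y = T.numLeft k y + T.numRight k y := by
  rw [num, ← Finset.card_filter_add_card_filter_not (fun c : ℕ × ℕ => c.2 < k),
    Finset.filter_filter, Finset.filter_filter]
  simp only [numLeft, numRight, and_comm, not_lt]

theorem numRight_swap (hS : (S : Set (ℕ × ℕ)).OrdConnected) (T : SVT S) {i k : ℕ}
    (hk : ∀ r, i ∉ T.entry (r, k)) (y : ℕ) :
    (T.swap hS i k hk).numRight k y = T.numRight k y := by
  unfold numRight
  congr 1
  refine Finset.filter_congr fun c _ => and_congr_right fun h => ?_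
  rw [swap_entry_of_le hS T hk h]

theorem not_mem_freeCols {T : SVT S} {i k r j : ℕ} (hj : j < k) (hA : T.Active i (r, j))
    (h : j ∉ T.freeCols i k r) : T.Active i (r + 1, j) ∨ ∃ s, s + 1 = r ∧ T.Active i (s, j) := by
  by_contra! hcon
  exact h (mem_freeCols.2 ⟨hj, hA, hcon.1, hcon.2⟩)

theorem numLeft_swap_left (hS : (S : Set (ℕ × ℕ)).OrdConnected) (T : SVT S) {i k : ℕ}
    (hk : ∀ r, i ∉ T.entry (r, k)) :
    (T.swap hS i k hk).numLeft k i = T.numLeft k (i + 1) := by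
  classical
  have down : ∀ {r j}, j < k → j ∉ T.freeCols i k r → i ∈ T.entry (r, j) →
      T.Active i (r + 1, j) := fun {r j} hj hn h => by
    rcases not_mem_freeCols hj (Or.inl h) hn with h' | ⟨s, rfl, h'⟩
    · exact h'
    · exact absurd h (h'.pair (Or.inl h)).2.2.1
  have up : ∀ {r j}, j < k → j ∉ T.freeCols i k r → i + 1 ∈ T.entry (r, j) →
      ∃ s, s + 1 = r ∧ T.Active i (s, j) := fun {r j} hj hn h => by
    rcases not_mem_freeCols hj (Or.inr h) hn with h' | h'
    · exact absurd h (Active.pair (Or.inr h) h').2.1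
    · exact h'
  refine Finset.card_nbij'
    (fun c => if c.2 ∈ T.freeCols i k c.1 then (c.1, (T.freeCols i k c.1).reflect c.2)
      else (c.1 + 1, c.2))
    (fun c => if c.2 ∈ T.freeCols i k c.1 then (c.1, (T.freeCols i k c.1).reflect c.2)
      else (c.1 - 1, c.2)) ?_ ?_ ?_ ?_
  · rintro ⟨r, j⟩ h
    rw [Finset.mem_coe, Finset.mem_filter] at h ⊢
    simp only [swap_entry] at h ⊢
    obtain ⟨-, hj, h⟩ := h
    by_cases hf : j ∈ T.freeCols i k r
    · rw [left_mem_swapEntry hf] at h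
      rw [if_pos hf]
      exact ⟨T.mem_cells h, (mem_freeCols.1 (reflect_mem_freeCols hS hf)).1, h⟩
    · rw [swapEntry_of_not_mem hf] at h
      rw [if_neg hf]
      have h' := down hj hf h
      exact ⟨h'.mem, hj, (Active.pair (Or.inl h) h').2.2.2⟩
  · rintro ⟨r, j⟩ h
    rw [Finset.mem_coe, Finset.mem_filter] at h ⊢
    simp only [swap_entry] at h ⊢
    obtain ⟨-, hj, h⟩ := h
    by_cases hf : j ∈ T.freeCols i k r
    · rw [if_pos hf]
      have hf' := reflect_mem_freeCols hS hf
      rw [left_mem_swapEntry hf', Finset.reflect_reflect hf]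
      exact ⟨(mem_freeCols.1 hf').2.1.mem, (mem_freeCols.1 hf').1, h⟩
    · rw [if_neg hf]
      obtain ⟨s, rfl, h'⟩ := up hj hf h
      rw [Nat.add_sub_cancel, swapEntry_of_not_mem fun hf' =>
        (mem_freeCols.1 hf').2.2.1 (Or.inr h)]
      exact ⟨h'.mem, hj, (h'.pair (Or.inr h)).1⟩
  · rintro ⟨r, j⟩ h
    rw [Finset.mem_coe, Finset.mem_filter] at h
    simp only [swap_entry] at h ⊢
    obtain ⟨-, hj, h⟩ := h
    by_cases hf : j ∈ T.freeCols i k r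
    · simp only [if_pos hf, if_pos (reflect_mem_freeCols hS hf), Finset.reflect_reflect hf]
    · rw [swapEntry_of_not_mem hf] at h
      have : j ∉ T.freeCols i k (r + 1) := fun hf' => (mem_freeCols.1 hf').2.2.2 r rfl (Or.inl h)
      simp only [if_neg hf, if_neg this, Nat.add_sub_cancel]
  · rintro ⟨r, j⟩ h
    rw [Finset.mem_coe, Finset.mem_filter] at h
    obtain ⟨-, hj, h⟩ := h
    by_cases hf : j ∈ T.freeCols i k r
    · simp only [if_pos hf, if_pos (reflect_mem_freeCols hS hf), Finset.reflect_reflect hf]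
    · obtain ⟨s, rfl, h'⟩ := up hj hf h
      have : j ∉ T.freeCols i k s := fun hf' => (mem_freeCols.1 hf').2.2.1 (Or.inr h)
      simp only [if_neg hf, Nat.add_sub_cancel, if_neg this]

theorem numLeft_swap_right (hS : (S : Set (ℕ × ℕ)).OrdConnected) (T : SVT S) {i k : ℕ}
    (hk : ∀ r, i ∉ T.entry (r, k)) :
    (T.swap hS i k hk).numLeft k (i + 1) = T.numLeft k i := by
  rw [← numLeft_swap_left hS _ (T.not_mem_swap hS hk), swap_swap]

/-- A box containing both `i` and `i + 1` in the swapped tableau comes from such a box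
in the same row. -/
theorem exists_double_of_swap (hS : (S : Set (ℕ × ℕ)).OrdConnected) (T : SVT S) {i k : ℕ}
    (hk : ∀ r, i ∉ T.entry (r, k)) {r j : ℕ} (h : i ∈ (T.swap hS i k hk).entry (r, j))
    (h' : i + 1 ∈ (T.swap hS i k hk).entry (r, j)) :
    ∃ j', i ∈ T.entry (r, j') ∧ i + 1 ∈ T.entry (r, j') := by
  rw [swap_entry] at h h'
  by_cases hf : j ∈ T.freeCols i k r
  · rw [left_mem_swapEntry hf] at h
    rw [right_mem_swapEntry hf] at h'
    exact ⟨_, h', h⟩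
  · rw [swapEntry_of_not_mem hf] at h h'
    exact ⟨_, h, h'⟩

theorem bounded_swap (hS : (S : Set (ℕ × ℕ)).OrdConnected) {T : SVT S} {i k m : ℕ}
    (hk : ∀ r, i ∉ T.entry (r, k)) (hi : i + 1 < m) (hT : T.Bounded m) :
    (T.swap hS i k hk).Bounded m := by
  intro c y hy
  by_cases h : y = i ∨ y = i + 1
  · omega
  · exact hT c y ((mem_swapEntry_of_ne (by omega) (by omega)).1 hy)

/-- The reading order of boxes, starting from the end of the word: `c` is read before `b`. -/
def Before (c b : ℕ × ℕ) : Prop := b.2 < c.2 ∨ c.2 = b.2 ∧ c.1 < b.1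

instance : DecidableRel Before := fun _ _ => inferInstanceAs (Decidable (_ ∨ _))

theorem Before.trans {a b c : ℕ × ℕ} (h : Before a b) (h' : Before b c) : Before a c := by
  unfold Before at *
  omega

theorem before_trichotomy (a b : ℕ × ℕ) : Before a b ∨ a = b ∨ Before b a := by
  unfold Before
  rw [Prod.ext_iff]
  omega

theorem not_before_self (a : ℕ × ℕ) : ¬ Before a a := by
  unfold Before
  omega

theorem exists_last {P : Finset (ℕ × ℕ)} (hP : P.Nonempty) :
    ∃ a ∈ P, ∀ b ∈ P, b = a ∨ Before b a := by
  obtain ⟨a, ha, h⟩ := P.exists_max_image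
    (fun c => (toLex (OrderDual.toDual c.2, c.1) : ℕᵒᵈ ×ₗ ℕ)) hP
  refine ⟨a, ha, fun b hb => ?_⟩
  have := h b hb
  rw [Prod.Lex.toLex_le_toLex] at this
  simp only [OrderDual.toDual_lt_toDual, EmbeddingLike.apply_eq_iff_eq] at this
  rw [Prod.ext_iff]
  unfold Before
  omega

theorem exists_first {P : Finset (ℕ × ℕ)} (hP : P.Nonempty) :
    ∃ a ∈ P, ∀ b ∈ P, b = a ∨ Before a b := by
  obtain ⟨a, ha, h⟩ := P.exists_min_image
    (fun c => (toLex (OrderDual.toDual c.2, c.1) : ℕᵒᵈ ×ₗ ℕ)) hP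
  refine ⟨a, ha, fun b hb => ?_⟩
  have := h b hb
  rw [Prod.Lex.toLex_le_toLex] at this
  simp only [OrderDual.toDual_lt_toDual, EmbeddingLike.apply_eq_iff_eq] at this
  rw [Prod.ext_iff]
  unfold Before
  omega

/-- The number of boxes containing `y` that are read before `b`. -/
def numBefore (T : SVT S) (y : ℕ) (b : ℕ × ℕ) : ℕ :=
  (S.filter fun c => Before c b ∧ y ∈ T.entry c).card

theorem numBefore_mono (T : SVT S) (y : ℕ) {c b : ℕ × ℕ} (h : Before c b) :
    T.numBefore y c + (if y ∈ T.entry c then 1 else 0) ≤ T.numBefore y b := by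
  unfold numBefore
  split_ifs with hy
  · rw [← Finset.card_insert_of_notMem (a := c) (by simp [not_before_self])]
    refine Finset.card_le_card fun x hx => ?_
    simp only [Finset.mem_insert, Finset.mem_filter] at hx ⊢
    rcases hx with rfl | ⟨hx, hb, hx'⟩
    · exact ⟨T.mem_cells hy, h, hy⟩
    · exact ⟨hx, hb.trans h, hx'⟩
  · refine Finset.card_le_card fun x hx => ?_
    simp only [Finset.mem_filter] at hx ⊢
    exact ⟨hx.1, hx.2.1.trans h, hx.2.2⟩

theorem numBefore_le (T : SVT S) (y : ℕ) {c b : ℕ × ℕ}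
    (h : ∀ x, Before x b → y ∈ T.entry x → x = c ∨ Before x c) :
    T.numBefore y b ≤ T.numBefore y c + (if y ∈ T.entry c then 1 else 0) := by
  unfold numBefore
  split_ifs with hy
  · rw [← Finset.card_insert_of_notMem (a := c) (by simp [not_before_self])]
    refine Finset.card_le_card fun x hx => ?_
    simp only [Finset.mem_insert, Finset.mem_filter] at hx ⊢
    exact (h x hx.2.1 hx.2.2).imp id fun h => ⟨hx.1, h, hx.2.2⟩
  · refine Finset.card_le_card fun x hx => ?_
    simp only [Finset.mem_filter] at hx ⊢
    refine ⟨hx.1, (h x hx.2.1 hx.2.2).resolve_left ?_, hx.2.2⟩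
    rintro rfl
    exact hy hx.2.2

/-- The suffixes of the word of `T` starting at a letter in the box `b` satisfy the
lattice condition for the letter `i + 1`. -/
def LatticeAt (T : SVT S) (b : ℕ × ℕ) (i : ℕ) : Prop :=
  i + 1 ∈ T.entry b → T.numBefore (i + 1) b < T.numBefore i b

theorem numBefore_succ_le {T : SVT S} {b : ℕ × ℕ} {i : ℕ}
    (h : ∀ c, Before c b → T.LatticeAt c i) : T.numBefore (i + 1) b ≤ T.numBefore i b := by
  rcases (S.filter fun c => Before c b ∧ i + 1 ∈ T.entry c).eq_empty_or_nonempty with he | he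
  · rw [numBefore, he]
    exact Nat.zero_le _
  · obtain ⟨a, ha, hl⟩ := exists_last he
    simp only [Finset.mem_filter] at ha hl
    have h1 := T.numBefore_le (i + 1) (c := a) (b := b) fun x hx hx' =>
      hl x ⟨T.mem_cells hx', hx, hx'⟩
    rw [if_pos ha.2.2] at h1
    have h2 := h a ha.2.1 ha.2.2
    have h3 := T.numBefore_mono i ha.2.1
    omega

/-- The reading of `T` first violates the lattice condition at the letter `i + 1` in box `b`. -/
structure FirstViolation (T : SVT S) (b : ℕ × ℕ) (i : ℕ) : Prop where
  mem : i + 1 ∈ T.entry b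
  le : T.numBefore i b ≤ T.numBefore (i + 1) b
  prior : ∀ c i', Before c b → T.LatticeAt c i'
  prior_box : ∀ i', i < i' → T.LatticeAt b i'

theorem exists_firstViolation {T : SVT S} {c : ℕ × ℕ} {i : ℕ} (h : ¬ T.LatticeAt c i) :
    ∃ b i, T.FirstViolation b i := by
  classical
  have hmem : ∀ {c i}, ¬ T.LatticeAt c i → i + 1 ∈ T.entry c ∧
      T.numBefore i c ≤ T.numBefore (i + 1) c := fun {c i} h => by
    simpa [LatticeAt] using h
  obtain ⟨b, hb, hl⟩ := exists_first (P := S.filter fun c => ∃ i, ¬ T.LatticeAt c i)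
    ⟨c, by simpa using ⟨T.mem_cells (hmem h).1, i, h⟩⟩
  simp only [Finset.mem_filter] at hb hl
  obtain ⟨hbS, i₀, hi₀⟩ := hb
  obtain ⟨k, hk, hmax⟩ := ((T.entry b).filter fun y =>
      ∃ i, y = i + 1 ∧ ¬ T.LatticeAt b i).exists_max_image
    id ⟨i₀ + 1, by simpa using ⟨(hmem hi₀).1, hi₀⟩⟩
  simp only [Finset.mem_filter, id] at hk hmax
  obtain ⟨hk, i, rfl, hi⟩ := hk
  refine ⟨b, i, hk, (hmem hi).2, fun c i' hc => ?_, fun i' hi' => ?_⟩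
  · by_contra hcon
    rcases hl c ⟨T.mem_cells (hmem hcon).1, i', hcon⟩ with rfl | h'
    · exact not_before_self _ hc
    · exact not_before_self _ (hc.trans h')
  · by_contra hcon
    have := hmax (i' + 1) ⟨(hmem hcon).1, i', rfl, hcon⟩
    omega

theorem FirstViolation.not_latticeAt {T : SVT S} {b : ℕ × ℕ} {i : ℕ}
    (h : T.FirstViolation b i) : ¬ T.LatticeAt b i := fun h' => by
  have := h' h.mem
  have := h.le
  omega

theorem FirstViolation.unique {T : SVT S} {b b' : ℕ × ℕ} {i i' : ℕ}
    (h : T.FirstViolation b i) (h' : T.FirstViolation b' i') : b = b' ∧ i = i' := by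
  rcases before_trichotomy b b' with hb | rfl | hb
  · exact absurd (h'.prior _ _ hb) h.not_latticeAt
  · refine ⟨rfl, ?_⟩
    rcases lt_trichotomy i i' with hi | hi | hi
    · exact absurd (h.prior_box _ hi) h'.not_latticeAt
    · exact hi
    · exact absurd (h'.prior_box _ hi) h.not_latticeAt
  · exact absurd (h.prior _ _ hb) h'.not_latticeAt

theorem FirstViolation.numBefore_eq {T : SVT S} {b : ℕ × ℕ} {i : ℕ}
    (h : T.FirstViolation b i) : T.numBefore i b = T.numBefore (i + 1) b :=
  h.le.antisymm (numBefore_succ_le fun c hc => h.prior c i hc)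

theorem FirstViolation.not_mem_col (hS : (S : Set (ℕ × ℕ)).OrdConnected) {T : SVT S}
    {r k i : ℕ} (h : T.FirstViolation (r, k) i) {s : ℕ} (hs : s ≠ r) : i ∉ T.entry (s, k) := by
  intro hi
  rcases hs.lt_or_gt with hs | hs
  · rcases (show s + 1 ≤ r from hs).eq_or_lt with rfl | hs'
    · have hb : Before (s, k) (s + 1, k) := Or.inr ⟨rfl, hs⟩
      have h1 := T.numBefore_mono i hb
      rw [if_pos hi] at h1
      have h2 := T.numBefore_le (i + 1) (c := (s, k)) (b := (s + 1, k)) fun x hx _ => by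
        rw [Prod.ext_iff]
        simp only [Before] at *
        omega
      have h3 : i + 1 ∉ T.entry (s, k) := fun h3 => by
        have := T.col_lt hS h3 h.mem hs
        omega
      rw [if_neg h3] at h2
      have h4 := numBefore_succ_le (T := T) (b := (s, k)) fun c hc => h.prior c i (hc.trans hb)
      have := h.le
      omega
    · have hm : (s + 1, k) ∈ S :=
        mem_of_between hS (T.mem_cells hi) (T.mem_cells h.mem) (by omega) hs le_rfl le_rfl
      obtain ⟨x, hx⟩ := T.nonempty_of_mem _ hm
      have := T.col_lt hS hi hx (Nat.lt_succ_self _)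
      have := T.col_lt hS hx h.mem hs'
      omega
  · have := T.col_lt hS h.mem hi hs
    omega

/-- The violation depends only on the entries in the columns up to the violating box,
and on the entries of this box that are larger than the violating letter. -/
theorem FirstViolation.congr {T U : SVT S} {r k i : ℕ} (h : T.FirstViolation (r, k) i)
    (hTU : ∀ c, Before c (r, k) → U.entry c = T.entry c)
    (hbox : ∀ y, i < y → (y ∈ U.entry (r, k) ↔ y ∈ T.entry (r, k))) :
    U.FirstViolation (r, k) i := by
  have hb : ∀ y c, (c = (r, k) ∨ Before c (r, k)) → U.numBefore y c = T.numBefore y c := by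
    intro y c hc
    unfold numBefore
    congr 1
    refine Finset.filter_congr fun x _ => and_congr_right fun hx => ?_
    rw [hTU]
    rcases hc with rfl | hc
    exacts [hx, hx.trans hc]
  refine ⟨(hbox _ (Nat.lt_succ_self _)).2 h.mem, ?_, fun c i' hc => ?_, fun i' hi' => ?_⟩
  · rw [hb _ _ (Or.inl rfl), hb _ _ (Or.inl rfl)]
    exact h.le
  · rw [LatticeAt, hb _ _ (Or.inr hc), hb _ _ (Or.inr hc), hTU c hc]
    exact h.prior c i' hc
  · rw [LatticeAt, hb _ _ (Or.inl rfl), hb _ _ (Or.inl rfl), hbox _ (by omega)]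
    exact h.prior_box i' hi'

section toggle

variable (T : SVT S) {d : ℕ × ℕ} {i : ℕ} (h0 : i + 1 ∈ T.entry d)
  (hl : ∀ j, j + 1 = d.2 → ∀ a ∈ T.entry (d.1, j), a ≤ i)
  (hu : ∀ s, s + 1 = d.1 → ∀ a ∈ T.entry (s, d.2), a < i)

theorem mem_update_symmDiff {f : ℕ × ℕ → Finset ℕ} {c d : ℕ × ℕ} {i y : ℕ} :
    y ∈ Function.update f d (symmDiff (f d) {i}) c ↔
      if c = d ∧ y = i then y ∉ f c else y ∈ f c := by
  rw [Function.update_apply]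
  by_cases hc : c = d <;> by_cases hy : y = i <;> simp [hc, hy, Finset.mem_symmDiff]

/-- Add `i` to a box containing `i + 1`, or remove it. -/
def toggle : SVT S where
  entry := Function.update T.entry d (symmDiff (T.entry d) {i})
  nonempty_of_mem c hc := by
    by_cases h : c = d
    · subst h
      exact ⟨i + 1, mem_update_symmDiff.2 (by simpa using h0)⟩
    · rw [Function.update_of_ne h]
      exact T.nonempty_of_mem c hc
  eq_empty_of_not_mem c hc := by
    rw [Function.update_of_ne, T.eq_empty_of_not_mem c hc]
    rintro rfl
    exact hc (T.mem_cells h0)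
  row_weak r j hc hc' a ha b hb := by
    rw [mem_update_symmDiff] at ha hb
    split_ifs at ha hb with h1 h2 h2
    · omega
    · obtain ⟨rfl, rfl⟩ := h1
      have := T.row_weak r j hc hc' _ h0 b hb
      omega
    · obtain ⟨rfl, rfl⟩ := h2
      exact hl j rfl a ha
    · exact T.row_weak r j hc hc' a ha b hb
  col_strict r j hc hc' a ha b hb := by
    rw [mem_update_symmDiff] at ha hb
    split_ifs at ha hb with h1 h2 h2
    · have := h1.1.trans h2.1.symm
      simp at this
    · obtain ⟨rfl, rfl⟩ := h1
      have := T.col_strict r j hc hc' _ h0 b hb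
      omega
    · obtain ⟨rfl, rfl⟩ := h2
      exact hu r rfl a ha
    · exact T.col_strict r j hc hc' a ha b hb

theorem mem_toggle {c : ℕ × ℕ} {y : ℕ} : y ∈ (T.toggle h0 hl hu).entry c ↔
    if c = d ∧ y = i then y ∉ T.entry c else y ∈ T.entry c :=
  mem_update_symmDiff

theorem mem_toggle_of_ne {c : ℕ × ℕ} {y : ℕ} (h : y ≠ i) :
    y ∈ (T.toggle h0 hl hu).entry c ↔ y ∈ T.entry c := by
  rw [mem_toggle, if_neg fun h' => h h'.2]

theorem toggle_entry_of_ne {c : ℕ × ℕ} (h : c ≠ d) :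
    (T.toggle h0 hl hu).entry c = T.entry c :=
  Function.update_of_ne h _ _

end toggle

/-- The leftmost column of row `r` containing `y`. -/
noncomputable def leftCol (T : SVT S) (y r : ℕ) : ℕ := sInf {j | y ∈ T.entry (r, j)}

theorem mem_leftCol {T : SVT S} {y r k : ℕ} (h : y ∈ T.entry (r, k)) :
    y ∈ T.entry (r, T.leftCol y r) :=
  Nat.sInf_mem (s := {j | y ∈ T.entry (r, j)}) ⟨k, h⟩

theorem leftCol_le {T : SVT S} {y r k : ℕ} (h : y ∈ T.entry (r, k)) : T.leftCol y r ≤ k :=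
  Nat.sInf_le h

theorem leftCol_congr {T U : SVT S} {y r : ℕ}
    (h : ∀ j, y ∈ T.entry (r, j) ↔ y ∈ U.entry (r, j)) : T.leftCol y r = U.leftCol y r := by
  simp only [leftCol, h]

/-- A box containing both `i` and `i + 1` is the leftmost one of its row containing `i + 1`. -/
theorem leftCol_eq (hS : (S : Set (ℕ × ℕ)).OrdConnected) {T : SVT S} {i r j : ℕ}
    (h : i ∈ T.entry (r, j)) (h' : i + 1 ∈ T.entry (r, j)) : T.leftCol (i + 1) r = j := by
  rcases (leftCol_le h').eq_or_lt with h1 | h1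
  · exact h1
  · have := T.row_le hS (mem_leftCol h') h h1
    omega

namespace FirstViolation

variable {T : SVT S} {r k i : ℕ}

theorem left_le (hS : (S : Set (ℕ × ℕ)).OrdConnected) (h : T.FirstViolation (r, k) i) (j : ℕ)
    (hj : j + 1 = T.leftCol (i + 1) r) (a : ℕ) (ha : a ∈ T.entry (r, j)) : a ≤ i := by
  have h1 := T.row_le hS ha (mem_leftCol h.mem) (by omega)
  rcases h1.eq_or_lt with rfl | h1
  · have := leftCol_le ha
    omega
  · omega

theorem upper_lt (hS : (S : Set (ℕ × ℕ)).OrdConnected) (h : T.FirstViolation (r, k) i) (s : ℕ)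
    (hs : s + 1 = r) (a : ℕ) (ha : a ∈ T.entry (s, T.leftCol (i + 1) r)) : a < i := by
  have hle := leftCol_le h.mem
  have hm : (s, k) ∈ S :=
    mem_of_between hS (T.mem_cells ha) (T.mem_cells h.mem) le_rfl (by omega) hle le_rfl
  have main : ∀ x ∈ T.entry (s, k), x < i := fun x hx => by
    have h1 := T.col_lt hS hx h.mem (by omega)
    have h2 : x ≠ i := by
      rintro rfl
      exact h.not_mem_col hS (by omega) hx
    omega
  rcases hle.eq_or_lt with h1 | h1
  · exact main a (h1 ▸ ha)
  · obtain ⟨x, hx⟩ := T.nonempty_of_mem _ hm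
    exact (T.row_le hS ha hx h1).trans_lt (main x hx)

/-- Toggle `i` in the leftmost box containing `i + 1` in the row of the violation. -/
noncomputable def toggle (hS : (S : Set (ℕ × ℕ)).OrdConnected)
    (h : T.FirstViolation (r, k) i) : SVT S :=
  T.toggle (d := (r, T.leftCol (i + 1) r)) (mem_leftCol h.mem) (h.left_le hS) (h.upper_lt hS)

theorem leftCol_toggle (hS : (S : Set (ℕ × ℕ)).OrdConnected) (h : T.FirstViolation (r, k) i) :
    (h.toggle hS).leftCol (i + 1) r = T.leftCol (i + 1) r :=
  leftCol_congr fun _ => T.mem_toggle_of_ne _ _ _ (Nat.succ_ne_self i)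

theorem firstViolation_toggle (hS : (S : Set (ℕ × ℕ)).OrdConnected)
    (h : T.FirstViolation (r, k) i) : (h.toggle hS).FirstViolation (r, k) i := by
  refine h.congr (fun c hc => T.toggle_entry_of_ne _ _ _ ?_)
    fun y hy => T.mem_toggle_of_ne _ _ _ hy.ne'
  rintro rfl
  have := leftCol_le h.mem
  simp only [Before] at hc
  omega

theorem toggle_toggle (hS : (S : Set (ℕ × ℕ)).OrdConnected) (h : T.FirstViolation (r, k) i) :
    (h.firstViolation_toggle hS).toggle hS = T := by
  ext c y
  rw [toggle, mem_toggle, leftCol_toggle, toggle, mem_toggle]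
  split_ifs <;> simp

theorem mem_toggle_iff (hS : (S : Set (ℕ × ℕ)).OrdConnected) (h : T.FirstViolation (r, k) i) :
    i ∈ (h.toggle hS).entry (r, (h.toggle hS).leftCol (i + 1) r) ↔
      i ∉ T.entry (r, T.leftCol (i + 1) r) := by
  rw [leftCol_toggle, toggle, mem_toggle, if_pos ⟨rfl, rfl⟩]

theorem bounded_toggle (hS : (S : Set (ℕ × ℕ)).OrdConnected) (h : T.FirstViolation (r, k) i)
    {m : ℕ} (hT : T.Bounded m) : (h.toggle hS).Bounded m := by
  intro c y hy
  by_cases hyi : y = i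
  · have := hT _ _ h.mem
    omega
  · exact hT c y ((T.mem_toggle_of_ne _ _ _ hyi).1 hy)

theorem not_mem_col_of_base (hS : (S : Set (ℕ × ℕ)).OrdConnected)
    (h : T.FirstViolation (r, k) i) (hb : i ∉ T.entry (r, T.leftCol (i + 1) r)) (s : ℕ) :
    i ∉ T.entry (s, k) := by
  by_cases hs : s = r
  · subst hs
    intro hi
    exact hb (leftCol_eq hS hi h.mem ▸ hi)
  · exact h.not_mem_col hS hs

theorem firstViolation_swap (hS : (S : Set (ℕ × ℕ)).OrdConnected)
    (h : T.FirstViolation (r, k) i) (hk : ∀ s, i ∉ T.entry (s, k)) :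
    (T.swap hS i k hk).FirstViolation (r, k) i := by
  refine h.congr (fun c hc => swap_entry_of_le hS T hk ?_) fun y _ => ?_
  · simp only [Before] at hc
    omega
  · rw [swap_entry_of_le hS T hk le_rfl]

theorem base_swap (hS : (S : Set (ℕ × ℕ)).OrdConnected)
    (h : T.FirstViolation (r, k) i) (hb : i ∉ T.entry (r, T.leftCol (i + 1) r)) :
    i ∉ (T.swap hS i k (h.not_mem_col_of_base hS hb)).entry
      (r, (T.swap hS i k (h.not_mem_col_of_base hS hb)).leftCol (i + 1) r) := by
  intro hi
  obtain ⟨j, hj, hj'⟩ := T.exists_double_of_swap hS (h.not_mem_col_of_base hS hb) hi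
    (mem_leftCol (h.firstViolation_swap hS _).mem)
  exact hb (leftCol_eq hS hj hj' ▸ hj)

theorem numRight_left (hS : (S : Set (ℕ × ℕ)).OrdConnected)
    (h : T.FirstViolation (r, k) i) (hb : i ∉ T.entry (r, T.leftCol (i + 1) r)) :
    T.numRight k i = T.numBefore i (r, k) := by
  unfold numRight numBefore
  congr 1
  refine Finset.filter_congr fun c _ => and_congr_left fun hc => ?_
  constructor
  · intro hk
    rcases hk.eq_or_lt with h1 | h1
    · exact absurd (h1 ▸ hc) (h.not_mem_col_of_base hS hb c.1)
    · exact Or.inl h1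
  · rintro (h1 | h1)
    exacts [le_of_lt h1, h1.1.ge]

theorem numRight_right (hS : (S : Set (ℕ × ℕ)).OrdConnected)
    (h : T.FirstViolation (r, k) i) :
    T.numRight k (i + 1) = T.numBefore (i + 1) (r, k) + 1 := by
  unfold numRight numBefore
  rw [← Finset.card_insert_of_notMem (a := (r, k)) (by simp [not_before_self])]
  congr 1
  ext ⟨s, j⟩
  rw [Finset.mem_filter, Finset.mem_insert, Finset.mem_filter, Prod.mk.injEq]
  simp only [Before]
  constructor
  · rintro ⟨hm, hk, hc⟩
    rcases hk.eq_or_lt with rfl | h1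
    · rcases lt_trichotomy s r with hs | hs | hs
      · exact Or.inr ⟨hm, Or.inr ⟨rfl, hs⟩, hc⟩
      · exact Or.inl ⟨hs, rfl⟩
      · have := T.col_lt hS h.mem hc hs
        omega
    · exact Or.inr ⟨hm, Or.inl h1, hc⟩
  · rintro (⟨rfl, rfl⟩ | ⟨hm, h1, hc⟩)
    · exact ⟨T.mem_cells h.mem, le_rfl, h.mem⟩
    · exact ⟨hm, by omega, hc⟩

end FirstViolation

/-- The signed monomial `(-1)^|T| x^T`. -/
noncomputable def weight (T : SVT S) : MvPolynomial ℕ ℤ :=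
  ∏ c ∈ S, ∏ y ∈ T.entry c, -X y

/-- The part of the signed monomial of `T` coming from the letters other than `i` and `i + 1`. -/
noncomputable def weightOther (T : SVT S) (i : ℕ) : MvPolynomial ℕ ℤ :=
  ∏ c ∈ S, ∏ y ∈ (T.entry c).filter (fun y => y ≠ i ∧ y ≠ i + 1), -X y

theorem weight_eq (T : SVT S) (i : ℕ) : T.weight =
    T.weightOther i * (-X i) ^ T.num i * (-X (i + 1)) ^ T.num (i + 1) := by
  have h : ∀ c ∈ S, ∏ y ∈ T.entry c, (-X y : MvPolynomial ℕ ℤ) =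
      (∏ y ∈ (T.entry c).filter (fun y => y ≠ i ∧ y ≠ i + 1), -X y) *
        (if i ∈ T.entry c then -X i else 1) * (if i + 1 ∈ T.entry c then -X (i + 1) else 1) := by
    intro c _
    have h1 : (if i ∈ T.entry c then -X i else 1 : MvPolynomial ℕ ℤ) =
        ∏ y ∈ T.entry c, if i = y then -X y else 1 := by
      rw [Finset.prod_ite_eq]
    have h2 : (if i + 1 ∈ T.entry c then -X (i + 1) else 1 : MvPolynomial ℕ ℤ) =
        ∏ y ∈ T.entry c, if i + 1 = y then -X y else 1 := by
      rw [Finset.prod_ite_eq]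
    rw [h1, h2, Finset.prod_filter, ← Finset.prod_mul_distrib, ← Finset.prod_mul_distrib]
    refine Finset.prod_congr rfl fun y _ => ?_
    by_cases hy : y = i
    · subst hy
      simp
    by_cases hy' : y = i + 1
    · subst hy'
      simp
    simp [hy, hy', Ne.symm hy, Ne.symm hy']
  rw [weight, Finset.prod_congr rfl h, Finset.prod_mul_distrib, Finset.prod_mul_distrib,
    ← Finset.prod_filter, ← Finset.prod_filter, Finset.prod_const, Finset.prod_const]
  rfl

theorem rename_weightOther (T : SVT S) (i : ℕ) :
    rename (Equiv.swap i (i + 1)) (T.weightOther i) = T.weightOther i := by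
  simp only [weightOther, map_prod, map_neg, rename_X]
  refine Finset.prod_congr rfl fun c _ => Finset.prod_congr rfl fun y hy => ?_
  rw [Finset.mem_filter] at hy
  rw [Equiv.swap_apply_of_ne_of_ne hy.2.1 hy.2.2]

theorem weightOther_swap (hS : (S : Set (ℕ × ℕ)).OrdConnected) (T : SVT S) {i k : ℕ}
    (hk : ∀ r, i ∉ T.entry (r, k)) :
    (T.swap hS i k hk).weightOther i = T.weightOther i := by
  refine Finset.prod_congr rfl fun c _ => ?_
  congr 1
  ext y
  simp only [Finset.mem_filter]
  exact and_congr_left fun h => mem_swapEntry_of_ne h.1 h.2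

theorem rename_weight_swap (hS : (S : Set (ℕ × ℕ)).OrdConnected) (T : SVT S) {i k : ℕ}
    (hk : ∀ r, i ∉ T.entry (r, k)) (h : T.numRight k i = 0) (h' : T.numRight k (i + 1) = 0) :
    rename (Equiv.swap i (i + 1)) T.weight = (T.swap hS i k hk).weight := by
  rw [weight_eq T i, weight_eq _ i, weightOther_swap]
  simp only [num_eq_add _ k, numRight_swap, numLeft_swap_left, numLeft_swap_right, h, h', map_mul,
    map_pow, map_neg, rename_X, rename_weightOther, Equiv.swap_apply_left, Equiv.swap_apply_right]
  ring

theorem rename_X_mul_weight_swap (hS : (S : Set (ℕ × ℕ)).OrdConnected) (T : SVT S) {i k : ℕ}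
    (hk : ∀ r, i ∉ T.entry (r, k)) (h : T.numRight k (i + 1) = T.numRight k i + 1) :
    rename (Equiv.swap i (i + 1)) (X i * T.weight) = X i * (T.swap hS i k hk).weight := by
  rw [weight_eq T i, weight_eq _ i, weightOther_swap]
  simp only [num_eq_add _ k, numRight_swap, numLeft_swap_left, numLeft_swap_right, h, map_mul,
    map_pow, map_neg, rename_X, rename_weightOther, Equiv.swap_apply_left, Equiv.swap_apply_right]
  ring

theorem weight_toggle (hS : (S : Set (ℕ × ℕ)).OrdConnected) {T : SVT S} {r k i : ℕ}
    (h : T.FirstViolation (r, k) i) (hb : i ∉ T.entry (r, T.leftCol (i + 1) r)) :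
    (h.toggle hS).weight = -X i * T.weight := by
  have hd : (r, T.leftCol (i + 1) r) ∈ S := T.mem_cells (mem_leftCol h.mem)
  have he : (h.toggle hS).entry (r, T.leftCol (i + 1) r) =
      insert i (T.entry (r, T.leftCol (i + 1) r)) := by
    ext y
    rw [FirstViolation.toggle, mem_toggle, Finset.mem_insert]
    by_cases hy : y = i <;> simp [hy, hb]
  rw [weight, weight, ← Finset.mul_prod_erase _ _ hd, ← Finset.mul_prod_erase _ _ hd, he,
    Finset.prod_insert hb, mul_assoc]
  congr 2
  refine Finset.prod_congr rfl fun c hc => ?_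
  rw [FirstViolation.toggle, toggle_entry_of_ne _ _ _ _ (Finset.ne_of_mem_erase hc)]

end SVT

theorem isRLW_cons {a : ℕ} {l : List ℕ} :
    IsRLW (a :: l) ↔ IsRLW l ∧ ∀ i, i + 1 = a → l.count (i + 1) < l.count i := by
  constructor
  · intro h
    refine ⟨fun s hs => h s (hs.trans (List.suffix_cons a l)), ?_⟩
    rintro i rfl
    have := h _ List.suffix_rfl i
    rw [List.count_cons_self, List.count_cons_of_ne (Nat.succ_ne_self i)] at this
    exact this
  · rintro ⟨h, h'⟩ s hs i
    rcases List.suffix_cons_iff.1 hs with rfl | hs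
    · have h1 := h l List.suffix_rfl i
      rw [List.count_cons, List.count_cons]
      by_cases ha : i + 1 = a
      · have := h' i ha
        subst ha
        simp
        omega
      · have : ¬ a = i + 1 := fun h => ha h.symm
        simp [this]
        omega
    · exact h s hs i

theorem isRLW_append {l W : List ℕ} (hl : l.Pairwise (· < ·)) :
    IsRLW (l ++ W) ↔ IsRLW W ∧ ∀ i, i + 1 ∈ l → W.count (i + 1) < W.count i := by
  induction l with
  | nil => simp
  | cons a l ih =>
    rw [List.pairwise_cons] at hl
    rw [List.cons_append, isRLW_cons, ih hl.2, and_assoc]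
    refine and_congr_right fun _ => ?_
    have hcount : ∀ y, y ≤ a → (l ++ W).count y = W.count y := fun y hy => by
      rw [List.count_append, List.count_eq_zero.2, zero_add]
      intro hm
      have := hl.1 y hm
      omega
    constructor
    · rintro ⟨h1, h2⟩ i hi
      rcases List.mem_cons.1 hi with hi | hi
      · have := h2 i hi
        rwa [hcount _ hi.le, hcount _ (by omega)] at this
      · exact h1 i hi
    · intro h
      refine ⟨fun i hi => h i (List.mem_cons_of_mem _ hi), fun i hi => ?_⟩
      rw [hcount _ hi.le, hcount _ (by omega)]
      exact h i (List.mem_cons.2 (Or.inl hi))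

theorem count_flatMap_sort {α : Type*} (L : List α) (f : α → Finset ℕ) (y : ℕ) :
    (L.flatMap fun c => (f c).sort (· ≤ ·)).count y = L.countP fun c => y ∈ f c := by
  induction L with
  | nil => simp
  | cons a L ih =>
    rw [List.flatMap_cons, List.count_append, ih, List.countP_cons, add_comm]
    congr 1
    by_cases h : y ∈ f a
    · rw [List.count_eq_one_of_mem (Finset.sort_nodup _ _) ((Finset.mem_sort _).2 h)]
      simp [h]
    · rw [List.count_eq_zero.2 fun h' => h ((Finset.mem_sort _).1 h')]
      simp [h]

theorem isRLW_flatMap_sort {α : Type*} (L : List α) (f : α → Finset ℕ) :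
    IsRLW (L.flatMap fun c => (f c).sort (· ≤ ·)) ↔ ∀ b L', (b :: L') <:+ L → ∀ i, i + 1 ∈ f b →
      (L'.countP fun c => i + 1 ∈ f c) < L'.countP fun c => i ∈ f c := by
  induction L with
  | nil =>
    refine iff_of_true (fun s hs i => ?_) fun b L' h => by simp at h
    rw [List.flatMap_nil, List.suffix_nil] at hs
    simp [hs]
  | cons a L ih =>
    rw [List.flatMap_cons, isRLW_append (Finset.sortedLT_sort _).pairwise, ih]
    simp only [count_flatMap_sort, Finset.mem_sort]
    constructor
    · rintro ⟨h1, h2⟩ b L' hs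
      rcases List.suffix_cons_iff.1 hs with h | h
      · obtain ⟨rfl, rfl⟩ := List.cons.inj h
        exact h2
      · exact h1 b L' h
    · intro h
      exact ⟨fun b L' hs => h b L' (hs.trans (List.suffix_cons a L)), h a L List.suffix_rfl⟩

namespace SVT

variable {S : Finset (ℕ × ℕ)}

/-- The boxes of an `n × n` square, column by column from left to right, each column from bottom
to top. -/
def squareBoxes (n : ℕ) : List (ℕ × ℕ) :=
  (List.range n).flatMap fun j => (List.range n).reverse.map fun i => (i, j)

theorem mem_squareBoxes {n : ℕ} {c : ℕ × ℕ} : c ∈ squareBoxes n ↔ c.1 < n ∧ c.2 < n := by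
  obtain ⟨i, j⟩ := c
  simp only [squareBoxes, List.mem_flatMap, List.mem_map, List.mem_reverse, List.mem_range,
    Prod.mk.injEq]
  constructor
  · rintro ⟨j, hj, i, hi, rfl, rfl⟩
    exact ⟨hi, hj⟩
  · rintro ⟨hi, hj⟩
    exact ⟨j, hj, i, hi, rfl, rfl⟩

theorem pairwise_squareBoxes (n : ℕ) : (squareBoxes n).Pairwise fun a b => Before b a := by
  rw [squareBoxes, List.pairwise_flatMap]
  constructor
  · intro j _
    rw [List.pairwise_map, List.pairwise_reverse]
    exact List.pairwise_lt_range.imp fun h => Or.inr ⟨rfl, h⟩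
  · refine List.pairwise_lt_range.imp fun h x hx y hy => ?_
    simp only [List.mem_map] at hx hy
    obtain ⟨_, _, rfl⟩ := hx
    obtain ⟨_, _, rfl⟩ := hy
    exact Or.inl h

theorem nodup_of_pairwise_before {L : List (ℕ × ℕ)} (h : L.Pairwise fun a b => Before b a) :
    L.Nodup :=
  h.imp fun {a b} hab => by
    rintro rfl
    exact not_before_self _ hab

/-- The side of the square used in the definition of the word. -/
def wordBound (S : Finset (ℕ × ℕ)) : ℕ := (S.sup fun c => max c.1 c.2) + 1

theorem mem_squareBoxes_of_mem {c : ℕ × ℕ} (hc : c ∈ S) : c ∈ squareBoxes (wordBound S) := by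
  have := Finset.le_sup (f := fun c : ℕ × ℕ => max c.1 c.2) hc
  rw [mem_squareBoxes, wordBound]
  omega

theorem word_eq (T : SVT S) : T.word =
    (squareBoxes (wordBound S)).flatMap fun c => (T.entry c).sort (· ≤ ·) := by
  rw [squareBoxes, List.flatMap_assoc]
  simp only [List.flatMap_map]
  rfl

theorem countP_eq_card {L : List (ℕ × ℕ)} (hL : L.Nodup) (p : ℕ × ℕ → Prop) [DecidablePred p]
    {F : Finset (ℕ × ℕ)} (h : ∀ c, c ∈ F ↔ c ∈ L ∧ p c) : (L.countP fun c => p c) = F.card := by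
  rw [List.countP_eq_length_filter, ← List.toFinset_card_of_nodup (hL.filter _)]
  congr 1
  ext c
  simp [h]

theorem count_word (T : SVT S) (y : ℕ) : T.word.count y = T.num y := by
  rw [word_eq, count_flatMap_sort]
  refine countP_eq_card (nodup_of_pairwise_before (pairwise_squareBoxes _)) _ fun c => ?_
  rw [Finset.mem_filter]
  exact and_congr_left fun h => iff_of_true (T.mem_cells h)
    (mem_squareBoxes_of_mem (T.mem_cells h))

theorem countP_eq_numBefore (T : SVT S) (y : ℕ) {b : ℕ × ℕ} {L' : List (ℕ × ℕ)}
    (h : (b :: L') <:+ squareBoxes (wordBound S)) :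
    (L'.countP fun c => y ∈ T.entry c) = T.numBefore y b := by
  obtain ⟨P, hP⟩ := h
  have hp := pairwise_squareBoxes (wordBound S)
  rw [← hP, List.pairwise_append, List.pairwise_cons] at hp
  obtain ⟨-, ⟨h1, h2⟩, h3⟩ := hp
  refine countP_eq_card (nodup_of_pairwise_before h2) _ fun c => ?_
  rw [Finset.mem_filter]
  constructor
  · rintro ⟨hc, hb, hy⟩
    refine ⟨?_, hy⟩
    have := mem_squareBoxes_of_mem hc
    rw [← hP, List.mem_append, List.mem_cons] at this
    rcases this with h | rfl | h
    · exact absurd (hb.trans (h3 c h b (by simp))) (not_before_self _)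
    · exact absurd hb (not_before_self _)
    · exact h
  · rintro ⟨hc, hy⟩
    exact ⟨T.mem_cells hy, h1 c hc, hy⟩

theorem isRLW_word_iff (T : SVT S) : IsRLW T.word ↔ ∀ b i, T.LatticeAt b i := by
  rw [word_eq, isRLW_flatMap_sort]
  constructor
  · intro h b i hi
    obtain ⟨P, L', hL⟩ := List.append_of_mem (mem_squareBoxes_of_mem (T.mem_cells hi))
    have hs : (b :: L') <:+ squareBoxes (wordBound S) := ⟨P, hL.symm⟩
    have := h b L' hs i hi
    rwa [countP_eq_numBefore _ _ hs, countP_eq_numBefore _ _ hs] at this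
  · intro h b L' hs i hi
    rw [countP_eq_numBefore _ _ hs, countP_eq_numBefore _ _ hs]
    exact h b i hi

theorem not_isRLW_word_iff (T : SVT S) :
    ¬ IsRLW T.word ↔ ∃ p : (ℕ × ℕ) × ℕ, T.FirstViolation p.1 p.2 := by
  rw [isRLW_word_iff]
  constructor
  · intro h
    push Not at h
    obtain ⟨c, i, h⟩ := h
    obtain ⟨b, i, h⟩ := exists_firstViolation h
    exact ⟨(b, i), h⟩
  · rintro ⟨p, hp⟩ h
    exact hp.not_latticeAt (h _ _)

theorem finite_bounded (S : Finset (ℕ × ℕ)) (m : ℕ) : {T : SVT S | T.Bounded m}.Finite := by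
  have : Function.Injective (fun (T : {T : SVT S | T.Bounded m}) (c : S) =>
      (⟨T.1.entry c, Finset.mem_powerset.2 fun y hy => Finset.mem_range.2 (T.2 _ _ hy)⟩ :
        (Finset.range m).powerset)) := by
    rintro ⟨T, hT⟩ ⟨U, hU⟩ h
    rw [Subtype.mk.injEq]
    ext1 c
    by_cases hc : c ∈ S
    · exact congrArg Subtype.val (congrFun h ⟨c, hc⟩)
    · rw [T.eq_empty_of_not_mem c hc, U.eq_empty_of_not_mem c hc]
  exact Finite.of_injective _ this

/-- The finite set of set-valued tableaux with entries smaller than `m`. -/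
noncomputable def boundedTableaux (S : Finset (ℕ × ℕ)) (m : ℕ) : Finset (SVT S) :=
  (finite_bounded S m).toFinset

theorem mem_boundedTableaux {m : ℕ} {T : SVT S} : T ∈ boundedTableaux S m ↔ T.Bounded m :=
  (finite_bounded S m).mem_toFinset

theorem card_le_size (T : SVT S) : S.card ≤ T.size := by
  rw [size, Finset.card_eq_sum_ones]
  exact Finset.sum_le_sum fun c hc => (T.nonempty_of_mem c hc).card_pos

theorem weight_eq_smul_monomial (T : SVT S) : T.weight = (-1 : ℤ) ^ T.size • T.monomial := by
  have h : ∀ c ∈ S, ∏ y ∈ T.entry c, (-X y : MvPolynomial ℕ ℤ) =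
      (-1) ^ (T.entry c).card * ∏ y ∈ T.entry c, X y := fun c _ => Finset.prod_neg _
  rw [weight, Finset.prod_congr rfl h, Finset.prod_mul_distrib, Finset.prod_pow_eq_pow_sum,
    monomial, size, zsmul_eq_mul]
  push_cast
  rfl

theorem size_eq_sum_num (T : SVT S) {m : ℕ} (hT : T.Bounded m) :
    T.size = ∑ y ∈ Finset.range m, T.num y := by
  simp only [size, num, Finset.card_filter]
  rw [Finset.sum_comm]
  refine Finset.sum_congr rfl fun c _ => ?_
  rw [← Finset.card_filter]
  congr 1
  ext y
  simp only [Finset.mem_filter, Finset.mem_range]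
  exact ⟨fun h => ⟨hT c y h, h⟩, fun h => h.2⟩

theorem weight_eq_prod_num (T : SVT S) {m : ℕ} (hT : T.Bounded m) :
    T.weight = ∏ y ∈ Finset.range m, (-X y) ^ T.num y := by
  have h : ∀ c ∈ S, ∏ y ∈ T.entry c, (-X y : MvPolynomial ℕ ℤ) =
      ∏ y ∈ Finset.range m, if y ∈ T.entry c then -X y else 1 := fun c _ => by
    rw [← Finset.prod_filter]
    refine Finset.prod_congr ?_ fun _ _ => rfl
    ext y
    simp only [Finset.mem_filter, Finset.mem_range]
    exact ⟨fun h => ⟨hT c y h, h⟩, fun h => h.2⟩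
  rw [weight, Finset.prod_congr rfl h, Finset.prod_comm]
  refine Finset.prod_congr rfl fun y _ => ?_
  rw [← Finset.prod_filter, Finset.prod_const]
  rfl

end SVT

theorem grothendieck_eq_sum_weight (S : Finset (ℕ × ℕ)) (m : ℕ) :
    grothendieck S m = (-1 : ℤ) ^ S.card • ∑ T ∈ SVT.boundedTableaux S m, T.weight := by
  have h := finsum_mem_eq_finite_toFinset_sum
    (fun T : SVT S => ((-1 : ℤ) ^ (T.size - S.card)) • T.monomial) (SVT.finite_bounded S m)
  refine h.trans ?_
  rw [Finset.smul_sum]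
  refine Finset.sum_congr rfl fun T _ => ?_
  rw [SVT.weight_eq_smul_monomial, smul_smul, ← pow_add]
  congr 1
  obtain ⟨k, hk⟩ := Nat.exists_eq_add_of_le T.card_le_size
  rw [hk, Nat.add_sub_cancel_left, ← add_assoc, pow_add, Even.neg_one_pow ⟨_, rfl⟩, one_mul]

namespace SVT

variable {S : Finset (ℕ × ℕ)}

theorem rename_sum_weight (hS : (S : Set (ℕ × ℕ)).OrdConnected) {i m : ℕ} (hi : i + 1 < m) :
    rename (Equiv.swap i (i + 1)) (∑ T ∈ boundedTableaux S m, T.weight) =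
      ∑ T ∈ boundedTableaux S m, T.weight := by
  set k := S.sup Prod.snd + 1 with hkdef
  have hlt : ∀ c ∈ S, c.2 < k := fun c hc => Nat.lt_succ_of_le (Finset.le_sup (f := Prod.snd) hc)
  have hk : ∀ (T : SVT S) r, i ∉ T.entry (r, k) := fun T r h =>
    (hlt _ (T.mem_cells h)).false
  have h0 : ∀ (T : SVT S) y, T.numRight k y = 0 := fun T y => by
    rw [numRight, Finset.card_eq_zero, Finset.filter_eq_empty_iff]
    exact fun c hc h => (hlt c hc).not_ge h.1
  rw [map_sum]
  refine Finset.sum_bij' (fun T _ => T.swap hS i k (hk T)) (fun T _ => T.swap hS i k (hk T))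
    ?_ ?_ ?_ ?_ ?_
  · exact fun T hT => mem_boundedTableaux.2 (bounded_swap hS _ hi (mem_boundedTableaux.1 hT))
  · exact fun T hT => mem_boundedTableaux.2 (bounded_swap hS _ hi (mem_boundedTableaux.1 hT))
  · exact fun T _ => swap_swap hS T _
  · exact fun T _ => swap_swap hS T _
  · exact fun T _ => rename_weight_swap hS T _ (h0 T _) (h0 T _)

open Classical in
/-- The tableaux with entries smaller than `m` whose first violation is at the box `b` and the
letter `i`. -/
noncomputable def violating (S : Finset (ℕ × ℕ)) (m : ℕ) (b : ℕ × ℕ) (i : ℕ) : Finset (SVT S) :=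
  (boundedTableaux S m).filter fun T => T.FirstViolation b i

theorem mem_violating {m : ℕ} {b : ℕ × ℕ} {i : ℕ} {T : SVT S} :
    T ∈ violating S m b i ↔ T.Bounded m ∧ T.FirstViolation b i := by
  classical
  rw [violating, Finset.mem_filter, mem_boundedTableaux]

theorem sum_violating (hS : (S : Set (ℕ × ℕ)).OrdConnected) {m : ℕ} {r k i : ℕ}
    (hi : i + 1 < m) :
    ∃ g, ∑ T ∈ violating S m (r, k) i, T.weight = (1 - X i) * g ∧
      rename (Equiv.swap i (i + 1)) (X i * g) = X i * g := by
  classical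
  let base : SVT S → Prop := fun T => i ∉ T.entry (r, T.leftCol (i + 1) r)
  have hmem : ∀ {T}, T ∈ (violating S m (r, k) i).filter base ↔
      T.Bounded m ∧ T.FirstViolation (r, k) i ∧ base T := fun {T} => by
    rw [Finset.mem_filter, mem_violating, and_assoc]
  have hmem' : ∀ {T}, T ∈ (violating S m (r, k) i).filter (fun T => ¬ base T) ↔
      T.Bounded m ∧ T.FirstViolation (r, k) i ∧ ¬ base T := fun {T} => by
    rw [Finset.mem_filter, mem_violating, and_assoc]
  refine ⟨∑ T ∈ (violating S m (r, k) i).filter base, T.weight, ?_, ?_⟩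
  · rw [← Finset.sum_filter_add_sum_filter_not _ base, sub_mul, one_mul, sub_eq_add_neg]
    congr 1
    rw [← neg_mul, Finset.mul_sum]
    symm
    refine Finset.sum_bij' (fun T h => (hmem.1 h).2.1.toggle hS)
      (fun T h => (hmem'.1 h).2.1.toggle hS) ?_ ?_ ?_ ?_ ?_
    · intro T h
      obtain ⟨h1, h2, h3⟩ := hmem.1 h
      exact hmem'.2 ⟨h2.bounded_toggle hS h1, h2.firstViolation_toggle hS,
        not_not.2 ((h2.mem_toggle_iff hS).2 h3)⟩
    · intro T h
      obtain ⟨h1, h2, h3⟩ := hmem'.1 h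
      exact hmem.2 ⟨h2.bounded_toggle hS h1, h2.firstViolation_toggle hS,
        mt (h2.mem_toggle_iff hS).1 h3⟩
    · exact fun T h => (hmem.1 h).2.1.toggle_toggle hS
    · exact fun T h => (hmem'.1 h).2.1.toggle_toggle hS
    · exact fun T h => (weight_toggle hS (hmem.1 h).2.1 (hmem.1 h).2.2).symm
  · rw [Finset.mul_sum, map_sum]
    have hk : ∀ {T}, T ∈ (violating S m (r, k) i).filter base → ∀ s, i ∉ T.entry (s, k) :=
      fun h => (hmem.1 h).2.1.not_mem_col_of_base hS (hmem.1 h).2.2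
    have hsw : ∀ {T} (h : T ∈ (violating S m (r, k) i).filter base),
        T.swap hS i k (hk h) ∈ (violating S m (r, k) i).filter base := fun h =>
      hmem.2 ⟨bounded_swap hS _ hi (hmem.1 h).1, (hmem.1 h).2.1.firstViolation_swap hS _,
        (hmem.1 h).2.1.base_swap hS (hmem.1 h).2.2⟩
    refine Finset.sum_bij' (fun T h => T.swap hS i k (hk h)) (fun T h => T.swap hS i k (hk h))
      (fun T h => hsw h) (fun T h => hsw h) (fun T h => swap_swap hS T (hk h))
      (fun T h => swap_swap hS T (hk h)) fun T h => ?_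
    obtain ⟨-, h2, h3⟩ := hmem.1 h
    refine rename_X_mul_weight_swap hS T _ ?_
    rw [h2.numRight_right hS, h2.numRight_left hS h3, h2.numBefore_eq]

end SVT

theorem viaEmbedding_swap {α β : Type*} [DecidableEq α] [DecidableEq β] (ι : α ↪ β) (a b : α) :
    (Equiv.swap a b).viaEmbedding ι = Equiv.swap (ι a) (ι b) := by
  ext x
  by_cases hx : x ∈ Set.range ι
  · obtain ⟨y, rfl⟩ := hx
    rw [Equiv.Perm.viaEmbedding_apply, ← ι.injective.map_swap]
  · rw [Equiv.Perm.viaEmbedding_apply_of_notMem _ _ _ hx, Equiv.swap_apply_of_ne_of_ne]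
    · rintro rfl
      exact hx ⟨a, rfl⟩
    · rintro rfl
      exact hx ⟨b, rfl⟩

/-- The polynomial obtained by permuting the first `m` variables. -/
noncomputable def permute {m : ℕ} (w : Equiv.Perm (Fin m)) :
    MvPolynomial ℕ ℤ →ₐ[ℤ] MvPolynomial ℕ ℤ :=
  rename (w.viaEmbeddingHom Fin.valEmbedding)

theorem permute_mul {m : ℕ} (v w : Equiv.Perm (Fin m)) (f : MvPolynomial ℕ ℤ) :
    permute (v * w) f = permute v (permute w f) := by
  rw [permute, permute, permute, map_mul, rename_rename]
  rfl

theorem permute_X {m : ℕ} (w : Equiv.Perm (Fin m)) (j : Fin m) :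
    permute w (X j) = X (w j : ℕ) := by
  rw [permute, rename_X]
  exact congrArg X (Equiv.Perm.viaEmbedding_apply w Fin.valEmbedding j)

theorem permute_swap {m : ℕ} (a b : Fin m) :
    permute (Equiv.swap a b) = rename (Equiv.swap (a : ℕ) b) := by
  rw [permute, Equiv.Perm.viaEmbeddingHom_apply, viaEmbedding_swap]
  rfl

theorem permute_eq_self {m : ℕ} {f : MvPolynomial ℕ ℤ}
    (hf : ∀ i, i + 1 < m → rename (Equiv.swap i (i + 1)) f = f) (w : Equiv.Perm (Fin m)) :
    permute w f = f := by
  have h1 : permute (1 : Equiv.Perm (Fin m)) f = f := by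
    rw [permute, map_one]
    exact rename_id_apply f
  cases m with
  | zero => rwa [Subsingleton.elim w 1]
  | succ n =>
    let N : Submonoid (Equiv.Perm (Fin (n + 1))) :=
      { carrier := {w | permute w f = f}
        one_mem' := h1
        mul_mem' := fun {v w} hv hw => by
          rw [Set.mem_ofPred_eq] at *
          rw [permute_mul, hw, hv] }
    have : N = ⊤ := by
      rw [eq_top_iff, ← Equiv.Perm.mclosure_swap_castSucc_succ n, Submonoid.closure_le]
      rintro _ ⟨i, rfl⟩
      refine (congrArg (· f) (permute_swap _ _)).trans ?_
      exact hf i (by omega)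
    exact (this ▸ Submonoid.mem_top w : w ∈ N)

/-- The antisymmetrization of a polynomial with respect to the first `m` variables. -/
noncomputable def antisymmetrize (m : ℕ) : MvPolynomial ℕ ℤ →ₗ[ℤ] MvPolynomial ℕ ℤ :=
  ∑ w : Equiv.Perm (Fin m), (w.sign : ℤ) • (permute w).toLinearMap

theorem antisymmetrize_apply (m : ℕ) (f : MvPolynomial ℕ ℤ) :
    antisymmetrize m f = ∑ w : Equiv.Perm (Fin m), (w.sign : ℤ) • permute w f := by
  simp [antisymmetrize]

theorem antisymmetrize_eq_zero_of_permute {m : ℕ} {s : Equiv.Perm (Fin m)} (hs : s.sign = -1)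
    {f : MvPolynomial ℕ ℤ} (hf : permute s f = f) : antisymmetrize m f = 0 := by
  have h : antisymmetrize m f = -antisymmetrize m f := by
    rw [antisymmetrize_apply, ← Finset.sum_neg_distrib, ← Equiv.sum_comp (Equiv.mulRight s)]
    refine Finset.sum_congr rfl fun w _ => ?_
    rw [Equiv.coe_mulRight, permute_mul, hf, Equiv.Perm.sign_mul, hs, mul_neg_one,
      Units.val_neg, neg_smul]
  exact self_eq_neg.1 h

theorem antisymmetrize_eq_zero {m i : ℕ} (hi : i + 1 < m) {f : MvPolynomial ℕ ℤ}
    (hf : rename (Equiv.swap i (i + 1)) f = f) : antisymmetrize m f = 0 := by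
  have hne : (⟨i, Nat.lt_of_succ_lt hi⟩ : Fin m) ≠ ⟨i + 1, hi⟩ := fun h =>
    absurd (Fin.mk.inj h) (by omega)
  refine antisymmetrize_eq_zero_of_permute (Equiv.Perm.sign_swap hne) ?_
  rw [permute_swap]
  exact hf

theorem antisymmetrize_mul {m : ℕ} {f : MvPolynomial ℕ ℤ}
    (hf : ∀ i, i + 1 < m → rename (Equiv.swap i (i + 1)) f = f) (g : MvPolynomial ℕ ℤ) :
    antisymmetrize m (f * g) = f * antisymmetrize m g := by
  simp only [antisymmetrize_apply, Finset.mul_sum, map_mul, permute_eq_self hf, mul_smul_comm]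

/-- The diagonal product of the matrix with entries `x_i ^ (m - 1 - j) * (1 - x_i) ^ j`. -/
noncomputable def diagProd (m : ℕ) : MvPolynomial ℕ ℤ :=
  ∏ j ∈ Finset.range m, (1 - X j) ^ j * X j ^ (m - 1 - j)

theorem antisymmetrize_diagProd_ne_zero (m : ℕ) : antisymmetrize m (diagProd m) ≠ 0 := by
  have h : antisymmetrize m (diagProd m) = (Matrix.projVandermonde (fun j : Fin m => 1 - X (j : ℕ))
      fun j : Fin m => (X (j : ℕ) : MvPolynomial ℕ ℤ)).det := by
    rw [antisymmetrize_apply, Matrix.det_apply, diagProd, Finset.prod_range]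
    refine Finset.sum_congr rfl fun w _ => ?_
    rw [map_prod, Units.smul_def]
    congr 1
    refine Finset.prod_congr rfl fun j _ => ?_
    rw [Matrix.projVandermonde_apply, map_mul, map_pow, map_pow, map_sub, map_one, permute_X,
      Fin.val_rev, show m - (j + 1) = m - 1 - (j : ℕ) by omega]
  rw [h, Matrix.det_projVandermonde, Finset.prod_ne_zero_iff]
  refine fun i _ => Finset.prod_ne_zero_iff.2 fun j hj => ?_
  rw [Finset.mem_Ioi] at hj
  have : (1 - X (j : ℕ)) * X (i : ℕ) - (1 - X (i : ℕ)) * X (j : ℕ) =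
      (X (i : ℕ) - X (j : ℕ) : MvPolynomial ℕ ℤ) := by ring
  rw [this, sub_ne_zero]
  exact fun h => hj.ne (Fin.ext (X_injective h))

theorem antisymmetrize_mul_diagProd_eq_zero {m i : ℕ} (hi : i + 1 < m) {g : MvPolynomial ℕ ℤ}
    (hg : rename (Equiv.swap i (i + 1)) (X i * g) = X i * g) :
    antisymmetrize m ((1 - X i) * g * diagProd m) = 0 := by
  refine antisymmetrize_eq_zero hi ?_
  obtain ⟨n, rfl⟩ : ∃ n, m = i + 2 + n := ⟨m - (i + 2), by omega⟩
  set R : MvPolynomial ℕ ℤ := ∏ j ∈ ((Finset.range (i + 2 + n)).erase i).erase (i + 1),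
    (1 - X j) ^ j * X j ^ (i + 2 + n - 1 - j) with hR
  have hRs : rename (Equiv.swap i (i + 1)) R = R := by
    rw [hR, map_prod]
    refine Finset.prod_congr rfl fun j hj => ?_
    simp only [Finset.mem_erase] at hj
    simp only [map_mul, map_pow, map_sub, map_one, rename_X,
      Equiv.swap_apply_of_ne_of_ne hj.2.1 hj.1]
  have h : (1 - X i) * g * diagProd (i + 2 + n) =
      X i * g * ((1 - X i) * (1 - X (i + 1))) ^ (i + 1) * (X i * X (i + 1)) ^ n * R := by
    rw [diagProd, ← Finset.mul_prod_erase _ _ (Finset.mem_range.2 (by omega : i < i + 2 + n)),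
      ← Finset.mul_prod_erase _ _ (Finset.mem_erase.2
        ⟨by omega, Finset.mem_range.2 (by omega : i + 1 < i + 2 + n)⟩), ← hR,
      show i + 2 + n - 1 - i = n + 1 by omega, show i + 2 + n - 1 - (i + 1) = n by omega,
      mul_pow, mul_pow]
    generalize (X (i + 1) : MvPolynomial ℕ ℤ) = x
    ring
  rw [h]
  simp only [map_mul, map_pow, map_sub, map_one, rename_X, Equiv.swap_apply_left,
    Equiv.swap_apply_right, hRs] at hg ⊢
  rw [hg]
  ring

namespace SVT

variable {S : Finset (ℕ × ℕ)}

theorem sum_weight_mul (hS : (S : Set (ℕ × ℕ)).OrdConnected) (m : ℕ)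
    [DecidablePred fun T : SVT S => IsRLW T.word] :
    (∑ T ∈ boundedTableaux S m, T.weight) * antisymmetrize m (diagProd m) =
      ∑ T ∈ boundedTableaux S m with IsRLW T.word, antisymmetrize m (T.weight * diagProd m) := by
  classical
  rw [← antisymmetrize_mul (fun i hi => rename_sum_weight hS hi), Finset.sum_mul, map_sum,
    ← Finset.sum_filter_add_sum_filter_not _ (fun T : SVT S => IsRLW T.word), add_eq_left]
  set bad := (boundedTableaux S m).filter fun T => ¬ IsRLW T.word with hbad
  let key : SVT S → (ℕ × ℕ) × ℕ := fun T =>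
    if h : ∃ p : (ℕ × ℕ) × ℕ, T.FirstViolation p.1 p.2 then h.choose else default
  have hkey : ∀ T p, T ∈ bad ∧ key T = p ↔ T ∈ violating S m p.1 p.2 := fun T p => by
    rw [hbad, Finset.mem_filter, mem_boundedTableaux, not_isRLW_word_iff, mem_violating, and_assoc]
    refine and_congr_right fun _ => ?_
    have hspec : ∀ h : ∃ p : (ℕ × ℕ) × ℕ, T.FirstViolation p.1 p.2,
        T.FirstViolation (key T).1 (key T).2 := fun h => by
      simp only [key, dif_pos h]
      exact h.choose_spec
    constructor
    · rintro ⟨h, rfl⟩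
      exact hspec h
    · intro h
      obtain ⟨h1, h2⟩ := (hspec ⟨p, h⟩).unique h
      exact ⟨⟨p, h⟩, Prod.ext h1 h2⟩
  rw [← Finset.sum_fiberwise_of_maps_to fun T hT => Finset.mem_image_of_mem key hT]
  refine Finset.sum_eq_zero fun p hp => ?_
  obtain ⟨T, hT, hTp⟩ := Finset.mem_image.1 hp
  obtain ⟨hTm, hTv⟩ := mem_violating.1 ((hkey T p).1 ⟨hT, hTp⟩)
  have hfib : bad.filter (fun T => key T = p) = violating S m p.1 p.2 := by
    ext T
    rw [Finset.mem_filter, hkey]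
  have hi : p.2 + 1 < m := hTm _ _ hTv.mem
  obtain ⟨g, hg, hg'⟩ := sum_violating hS (r := p.1.1) (k := p.1.2) hi
  rw [hfib, ← map_sum, ← Finset.sum_mul, hg]
  exact antisymmetrize_mul_diagProd_eq_zero hi hg'

end SVT

namespace YoungDiagram

theorem ext_rowLen {mu nu : YoungDiagram} (h : ∀ i, mu.rowLen i = nu.rowLen i) : mu = nu := by
  ext ⟨i, j⟩
  rw [mem_cells, mem_cells, mem_iff_lt_rowLen, mem_iff_lt_rowLen, h]

theorem exists_rowLen_eq {f : ℕ → ℕ} (hf : Antitone f) {m : ℕ} (hm : ∀ i, m ≤ i → f i = 0) :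
    ∃ mu : YoungDiagram, ∀ i, mu.rowLen i = f i := by
  have hmem : ∀ i j, (i, j) ∈ (Finset.range m ×ˢ Finset.range (f 0)).filter
      (fun c => c.2 < f c.1) ↔ j < f i := fun i j => by
    simp only [Finset.mem_filter, Finset.mem_product, Finset.mem_range]
    refine ⟨fun h => h.2, fun h => ⟨⟨?_, h.trans_le (hf i.zero_le)⟩, h⟩⟩
    by_contra! hi
    have := hm i hi
    omega
  refine ⟨⟨(Finset.range m ×ˢ Finset.range (f 0)).filter fun c => c.2 < f c.1, ?_⟩, fun i => ?_⟩
  · rintro ⟨i, j⟩ ⟨i', j'⟩ h h'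
    rw [Finset.mem_coe, hmem] at *
    exact (h.2.trans_lt h').trans_le (hf h.1)
  · refine eq_of_forall_lt_iff fun j => ?_
    rw [← mem_iff_lt_rowLen, ← mem_cells]
    exact hmem i j

theorem ordConnected_cells (mu : YoungDiagram) : (mu.cells : Set (ℕ × ℕ)).OrdConnected :=
  mu.isLowerSet.ordConnected

theorem ordConnected_skew (lam nu : YoungDiagram) :
    ((nu.cells \ lam.cells : Finset (ℕ × ℕ)) : Set (ℕ × ℕ)).OrdConnected := by
  rw [Finset.coe_sdiff, Set.sdiff_eq]
  exact nu.isLowerSet.ordConnected.inter lam.isLowerSet.compl.ordConnected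

end YoungDiagram

namespace SVT

variable {S : Finset (ℕ × ℕ)}

theorem hasContent_word_iff (T : SVT S) (mu : YoungDiagram) :
    HasContent T.word mu ↔ ∀ i, T.num i = mu.rowLen i := by
  simp only [HasContent, count_word]

theorem bounded_iff_num (T : SVT S) (m : ℕ) : T.Bounded m ↔ ∀ i, m ≤ i → T.num i = 0 := by
  constructor
  · intro h i hi
    rw [num, Finset.card_eq_zero, Finset.filter_eq_empty_iff]
    exact fun c _ hc => (h c i hc).not_ge hi
  · intro h c x hx
    by_contra! hm
    have := h x hm
    rw [num, Finset.card_eq_zero, Finset.filter_eq_empty_iff] at this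
    exact this (T.mem_cells hx) hx

theorem exists_content {T : SVT S} (h : IsRLW T.word) {m : ℕ} (hm : T.Bounded m) :
    ∃ mu : YoungDiagram, ∀ i, T.num i = mu.rowLen i := by
  obtain ⟨mu, hmu⟩ := YoungDiagram.exists_rowLen_eq (antitone_nat_of_succ_le fun i => by
    rw [← count_word, ← count_word]
    exact h _ List.suffix_rfl i) ((T.bounded_iff_num m).1 hm)
  exact ⟨mu, fun i => (hmu i).symm⟩

/-- The tableau of straight shape `mu` whose row `r` is filled with the letter `r`. -/
def superstandard (mu : YoungDiagram) : SVT mu.cells where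
  entry c := if c ∈ mu.cells then {c.1} else ∅
  nonempty_of_mem c hc := by simp [hc]
  eq_empty_of_not_mem c hc := if_neg hc
  row_weak i j h h' a ha b hb := by
    rw [if_pos h, Finset.mem_singleton] at ha
    rw [if_pos h', Finset.mem_singleton] at hb
    exact (ha.trans hb.symm).le
  col_strict i j h h' a ha b hb := by
    rw [if_pos h, Finset.mem_singleton] at ha
    rw [if_pos h', Finset.mem_singleton] at hb
    omega

theorem mem_superstandard {mu : YoungDiagram} {c : ℕ × ℕ} {y : ℕ} :
    y ∈ (superstandard mu).entry c ↔ c ∈ mu.cells ∧ y = c.1 := by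
  unfold superstandard
  by_cases h : c ∈ mu.cells <;> simp [h]

theorem num_superstandard (mu : YoungDiagram) (y : ℕ) :
    (superstandard mu).num y = mu.rowLen y := by
  rw [num, YoungDiagram.rowLen_eq_card, YoungDiagram.row]
  congr 1
  refine Finset.filter_congr fun c hc => ?_
  rw [mem_superstandard, eq_comm, and_iff_right hc]

theorem size_superstandard (mu : YoungDiagram) : (superstandard mu).size = mu.card := by
  rw [size, YoungDiagram.card, Finset.card_eq_sum_ones]
  refine Finset.sum_congr rfl fun c hc => ?_
  exact (congrArg Finset.card (if_pos hc)).trans (Finset.card_singleton _)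

theorem isRLW_superstandard (mu : YoungDiagram) : IsRLW (superstandard mu).word := by
  rw [isRLW_word_iff]
  rintro ⟨r, k⟩ i hi
  obtain ⟨hmem, rfl⟩ := mem_superstandard.1 hi
  have hup : ∀ j, (i + 1, j) ∈ mu.cells → (i, j) ∈ mu.cells := fun j h =>
    mu.isLowerSet (Prod.mk_le_mk.2 ⟨i.le_succ, le_rfl⟩) h
  have hcard : (superstandard mu).numBefore (i + 1) (i + 1, k) =
      ((mu.cells.filter fun c => Before c (i + 1, k) ∧
        i + 1 ∈ (superstandard mu).entry c).image fun c => (i, c.2)).card := by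
    refine (Finset.card_image_of_injOn ?_).symm
    rintro ⟨r, j⟩ hc ⟨r', j'⟩ hc' h
    obtain ⟨-, -, h1⟩ := Finset.mem_filter.1 hc
    obtain ⟨-, -, h2⟩ := Finset.mem_filter.1 hc'
    exact Prod.ext ((mem_superstandard.1 h1).2.symm.trans (mem_superstandard.1 h2).2)
      (Prod.mk.inj h).2
  rw [hcard]
  refine Finset.card_lt_card (Finset.ssubset_iff.2 ⟨(i, k), ?_, ?_⟩)
  · rw [Finset.mem_image]
    rintro ⟨⟨r, j⟩, hc, h⟩
    obtain ⟨-, hb, h1⟩ := Finset.mem_filter.1 hc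
    have h2 := (mem_superstandard.1 h1).2
    have h3 := (Prod.mk.inj h).2
    simp only [Before] at hb h2 h3
    omega
  · rw [Finset.insert_subset_iff]
    constructor
    · exact Finset.mem_filter.2 ⟨hup k hmem, Or.inr ⟨rfl, i.lt_succ_self⟩,
        mem_superstandard.2 ⟨hup k hmem, rfl⟩⟩
    · rw [Finset.image_subset_iff]
      rintro ⟨r, j⟩ hc
      obtain ⟨hm, hb, h1⟩ := Finset.mem_filter.1 hc
      obtain rfl : i + 1 = r := (mem_superstandard.1 h1).2
      refine Finset.mem_filter.2 ⟨hup j hm, Or.inl ?_, mem_superstandard.2 ⟨hup j hm, rfl⟩⟩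
      simp only [Before] at hb
      omega

theorem le_row_of_isRLW {mu : YoungDiagram} {T : SVT mu.cells} (h : IsRLW T.word) {x : ℕ} :
    ∀ {r k : ℕ}, x ∈ T.entry (r, k) → x ≤ r := by
  have hS := mu.ordConnected_cells
  induction x with
  | zero => exact fun _ => Nat.zero_le _
  | succ x ih =>
    intro r k hx
    have hpos := (Nat.zero_le _).trans_lt ((T.isRLW_word_iff.1 h) (r, k) x hx)
    obtain ⟨⟨r', k'⟩, hc⟩ := Finset.card_pos.1 hpos
    obtain ⟨hc, hb, hx'⟩ := Finset.mem_filter.1 hc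
    have := ih hx'
    by_contra! hlt
    have hk : k < k' := by
      simp only [Before] at hb
      omega
    obtain ⟨z, hz⟩ := T.nonempty_of_mem (r, k')
      (mu.isLowerSet (Prod.mk_le_mk.2 ⟨(by omega : r ≤ r'), le_rfl⟩) hc)
    have h1 := T.row_le hS hx hz hk
    rcases (show r ≤ r' by omega).eq_or_lt with rfl | hr
    · have := T.row_le hS hx hx' hk
      omega
    · have := T.col_lt hS hz hx' hr
      omega

theorem row_le_of_mem {mu : YoungDiagram} (T : SVT mu.cells) {r : ℕ} :
    ∀ {k x : ℕ}, x ∈ T.entry (r, k) → r ≤ x := by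
  induction r with
  | zero => exact fun _ => Nat.zero_le _
  | succ r ih =>
    intro k x hx
    obtain ⟨y, hy⟩ := T.nonempty_of_mem (r, k)
      (mu.isLowerSet (Prod.mk_le_mk.2 ⟨r.le_succ, le_rfl⟩) (T.mem_cells hx))
    have h1 := ih hy
    have h2 := T.col_lt mu.ordConnected_cells hy hx r.lt_succ_self
    omega

theorem eq_superstandard {mu : YoungDiagram} {T : SVT mu.cells} (h : IsRLW T.word) :
    T = superstandard mu := by
  have heq : ∀ c, ∀ x ∈ T.entry c, x = c.1 := fun c x hx =>
    (le_row_of_isRLW h hx).antisymm (T.row_le_of_mem hx)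
  ext c x
  rw [mem_superstandard]
  refine ⟨fun hx => ⟨T.mem_cells hx, heq c x hx⟩, ?_⟩
  rintro ⟨hc, rfl⟩
  obtain ⟨y, hy⟩ := T.nonempty_of_mem c hc
  exact heq c y hy ▸ hy

theorem sum_weight_mul_of_bounded {mu : YoungDiagram} {m : ℕ}
    (h : (superstandard mu).Bounded m) :
    (∑ T ∈ boundedTableaux mu.cells m, T.weight) * antisymmetrize m (diagProd m) =
      antisymmetrize m ((superstandard mu).weight * diagProd m) := by
  classical
  rw [sum_weight_mul mu.ordConnected_cells]
  exact Finset.sum_eq_single_of_mem _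
    (Finset.mem_filter.2 ⟨mem_boundedTableaux.2 h, isRLW_superstandard mu⟩)
    fun T hT hne => absurd (eq_superstandard (Finset.mem_filter.1 hT).2) hne

theorem bounded_superstandard {mu : YoungDiagram} {m : ℕ}
    (h : ∑ T ∈ boundedTableaux mu.cells m, T.weight ≠ 0) : (superstandard mu).Bounded m := by
  classical
  by_contra hb
  refine mul_ne_zero h (antisymmetrize_diagProd_ne_zero m) ?_
  rw [sum_weight_mul mu.ordConnected_cells]
  refine Finset.sum_eq_zero fun T hT => absurd ?_ hb
  obtain ⟨hT, hR⟩ := Finset.mem_filter.1 hT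
  exact eq_superstandard hR ▸ mem_boundedTableaux.1 hT

theorem bounded_superstandard_iff {T : SVT S} {mu : YoungDiagram}
    (h : ∀ i, T.num i = mu.rowLen i) (m : ℕ) :
    (superstandard mu).Bounded m ↔ T.Bounded m := by
  simp only [bounded_iff_num, h, num_superstandard]

theorem card_le_card_content {T : SVT S} {mu : YoungDiagram}
    (h : ∀ i, T.num i = mu.rowLen i) {m : ℕ} (hT : T.Bounded m) : S.card ≤ mu.card := by
  refine T.card_le_size.trans_eq ?_
  rw [← size_superstandard, size_eq_sum_num T hT,
    size_eq_sum_num _ ((bounded_superstandard_iff h m).2 hT)]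
  simp only [num_superstandard, h]

theorem exists_content_map (S : Finset (ℕ × ℕ)) (m : ℕ) : ∃ content : SVT S → YoungDiagram,
    ∀ T : SVT S, T.Bounded m → IsRLW T.word → ∀ i, T.num i = (content T).rowLen i := by
  have : ∀ T : SVT S, ∃ mu : YoungDiagram,
      T.Bounded m → IsRLW T.word → ∀ i, T.num i = mu.rowLen i := fun T => by
    by_cases h : T.Bounded m ∧ IsRLW T.word
    · obtain ⟨mu, hmu⟩ := exists_content h.2 h.1
      exact ⟨mu, fun _ _ => hmu⟩
    · exact ⟨⊥, fun h1 h2 => absurd ⟨h1, h2⟩ h⟩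
  choose f hf using this
  exact ⟨f, hf⟩

theorem sum_weight_eq (hS : (S : Set (ℕ × ℕ)).OrdConnected) {m : ℕ}
    {content : SVT S → YoungDiagram}
    (hc : ∀ T : SVT S, T.Bounded m → IsRLW T.word → ∀ i, T.num i = (content T).rowLen i)
    [DecidablePred fun T : SVT S => IsRLW T.word] :
    ∑ T ∈ boundedTableaux S m, T.weight = ∑ T ∈ boundedTableaux S m with IsRLW T.word,
      ∑ U ∈ boundedTableaux (content T).cells m, U.weight := by
  refine mul_right_cancel₀ (antisymmetrize_diagProd_ne_zero m) ?_
  rw [sum_weight_mul hS, Finset.sum_mul]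
  refine Finset.sum_congr rfl fun T hT => ?_
  obtain ⟨hT, hR⟩ := Finset.mem_filter.1 hT
  rw [mem_boundedTableaux] at hT
  have hb := (bounded_superstandard_iff (hc T hT hR) m).2 hT
  rw [sum_weight_mul_of_bounded hb, weight_eq_prod_num T hT, weight_eq_prod_num _ hb]
  simp only [num_superstandard, hc T hT hR]

end SVT

theorem grothendieck_eq_finsum {S : Finset (ℕ × ℕ)} (hS : (S : Set (ℕ × ℕ)).OrdConnected)
    (m : ℕ) : grothendieck S m =
      ∑ᶠ mu : YoungDiagram, alphaCoeff S mu • grothendieck mu.cells m := by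
  classical
  obtain ⟨content, hc⟩ := SVT.exists_content_map S m
  set good := (SVT.boundedTableaux S m).filter fun T => IsRLW T.word with hgood
  have hmem : ∀ {T}, T ∈ good ↔ T.Bounded m ∧ IsRLW T.word := fun {T} => by
    rw [hgood, Finset.mem_filter, SVT.mem_boundedTableaux]
  have hcontent : ∀ {T mu}, T ∈ good → (content T = mu ↔ ∀ i, T.num i = mu.rowLen i) :=
    fun {T mu} hT => by
      have := hc T (hmem.1 hT).1 (hmem.1 hT).2
      refine ⟨fun h => h ▸ this, fun h => YoungDiagram.ext_rowLen fun i => ?_⟩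
      rw [← h, this]
  rw [finsum_eq_sum_of_support_subset (s := good.image content), grothendieck_eq_sum_weight,
    SVT.sum_weight_eq hS hc, ← hgood,
    Finset.sum_comp (fun mu => ∑ U ∈ SVT.boundedTableaux mu.cells m, U.weight) content,
    Finset.smul_sum]
  · refine Finset.sum_congr rfl fun mu hmu => ?_
    obtain ⟨T, hT, hTmu⟩ := Finset.mem_image.1 hmu
    have hnum := (hcontent hT).1 hTmu
    have hcard := SVT.card_le_card_content hnum (hmem.1 hT).1
    have hfib : Nat.card {T : SVT S // IsRLW T.word ∧ HasContent T.word mu} =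
        (good.filter fun T => content T = mu).card := by
      refine Nat.subtype_card _ fun U => ?_
      rw [Finset.mem_filter, SVT.hasContent_word_iff]
      constructor
      · rintro ⟨h1, h2⟩
        exact ⟨(hmem.1 h1).2, (hcontent h1).1 h2⟩
      · rintro ⟨h1, h2⟩
        have hU : U ∈ good := hmem.2 ⟨(SVT.bounded_superstandard_iff h2 m).1
          ((SVT.bounded_superstandard_iff hnum m).2 (hmem.1 hT).1), h1⟩
        exact ⟨hU, (hcontent hU).2 h2⟩
    rw [alphaCoeff, hfib, grothendieck_eq_sum_weight, smul_smul, ← natCast_zsmul, smul_smul]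
    congr 1
    obtain ⟨d, hd⟩ := Nat.exists_eq_add_of_le hcard
    change mu.cells.card = _ at hd
    rw [YoungDiagram.card, hd, Nat.add_sub_cancel_left, pow_add, mul_comm ((-1 : ℤ) ^ d), mul_assoc,
      mul_left_comm ((-1 : ℤ) ^ d), ← pow_add, Even.neg_one_pow ⟨_, rfl⟩, mul_one, mul_comm]
  · intro mu hmu
    rw [Function.mem_support] at hmu
    have hG := right_ne_zero_of_smul hmu
    rw [grothendieck_eq_sum_weight] at hG
    have hb := SVT.bounded_superstandard (right_ne_zero_of_smul hG)
    have hα : Nat.card {T : SVT S // IsRLW T.word ∧ HasContent T.word mu} ≠ 0 := fun h =>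
      left_ne_zero_of_smul hmu (by rw [alphaCoeff, h, Nat.cast_zero, mul_zero])
    obtain ⟨⟨T, hR, hT⟩⟩ := (Nat.card_ne_zero.1 hα).1
    rw [SVT.hasContent_word_iff] at hT
    have hgT : T ∈ good := hmem.2 ⟨(SVT.bounded_superstandard_iff hT m).1 hb, hR⟩
    exact Finset.mem_coe.2 (Finset.mem_image.2 ⟨T, hgT, (hcontent hgT).2 hT⟩)

/-- **Expansion of skew stable Grothendieck polynomials** (Theorem 6.9): for
partitions `λ ⊆ ν` and `m ≥ 1`,
`G_{ν/λ}(x_1,…,x_m) = Σ_μ α_{ν/λ,μ} G_μ(x_1,…,x_m)`,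
the (finitely supported) sum being over all partitions `μ`. -/
theorem skew_grothendieck_expansion (lam nu : YoungDiagram) (h : lam ≤ nu) (m : ℕ)
    (hm : 1 ≤ m) :
    grothendieck (nu.cells \ lam.cells) m =
      ∑ᶠ mu : YoungDiagram,
        alphaCoeff (nu.cells \ lam.cells) mu • grothendieck mu.cells m :=
  grothendieck_eq_finsum (YoungDiagram.ordConnected_skew lam nu) m
end

section
/- (Rectangular structure constants) Let p, q ≥ 1, let R = (q^p) be the rectangular partition with p rows and q columns, and let λ and μ be partitions with μ ⊆ R. Let μ̂ = {(i,j) : 1 ≤ i ≤ p, q − μ_{p+1−i} < j ≤ q} (with μ_k = 0 for k > ℓ(μ)) be μ rotated 180 degrees and placed in the lower-right corner of R. If c^R_{λμ} ≠ 0, then λ ⊆ R, λ ∩ μ̂ = ∅, λ ∪ μ̂ = R (so R is the disjoint union of λ and μ̂, and in particular |λ| + |μ| = pq), and moreover c^R_{λμ} = 1. -/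
open MvPolynomial

/-- The partition `μ ⊆ (q^p)` rotated 180 degrees and placed in the lower-right
corner of the `p × q` rectangle. -/
def muHat (p q : ℕ) (mu : YoungDiagram) : Finset (ℕ × ℕ) :=
  (Finset.range p ×ˢ Finset.range q).filter fun c => q - mu.rowLen (p - 1 - c.1) ≤ c.2

namespace SVT

variable {cells : Finset (ℕ × ℕ)}

theorem mem_cells_of_mem_entry (T : SVT cells) {c : ℕ × ℕ} {x : ℕ} (hx : x ∈ T.entry c) :
    c ∈ cells := by
  by_contra hc
  simp [T.eq_empty_of_not_mem c hc] at hx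

/-- The part of the column word of `T` coming from the first `n` boxes of column `j`. -/
def colWord (T : SVT cells) (n j : ℕ) : List ℕ :=
  (List.range n).reverse.flatMap fun i => (T.entry (i, j)).sort (· ≤ ·)

theorem count_sort (s : Finset ℕ) (y : ℕ) :
    (s.sort (· ≤ ·)).count y = if y ∈ s then 1 else 0 := by
  rw [(Finset.sort_nodup s (· ≤ ·)).count]
  simp

theorem count_colWord (T : SVT cells) (n j y : ℕ) :
    (T.colWord n j).count y = ((Finset.range n).filter fun i => y ∈ T.entry (i, j)).card := by
  rw [colWord, List.count_flatMap, ← List.sum_toFinset _ (List.nodup_reverse.2 List.nodup_range),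
    Finset.card_filter]
  simp only [Function.comp_apply, count_sort, List.toFinset_reverse, List.toFinset_range]

theorem lt_of_mem_cells {c : ℕ × ℕ} (hc : c ∈ cells) :
    c.1 < (cells.sup fun c => max c.1 c.2) + 1 ∧ c.2 < (cells.sup fun c => max c.1 c.2) + 1 := by
  have := Finset.le_sup (f := fun c : ℕ × ℕ => max c.1 c.2) hc
  omega

theorem count_word_s19 (T : SVT cells) (y : ℕ) :
    T.word.count y = (cells.filter fun c => y ∈ T.entry c).card := by
  rw [word, List.count_flatMap, ← List.sum_toFinset _ List.nodup_range]
  change ∑ j ∈ _, (T.colWord _ j).count y = _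
  simp only [count_colWord, Finset.card_filter, List.toFinset_range]
  rw [Finset.sum_comm, ← Finset.sum_product', ← Finset.card_filter, ← Finset.card_filter]
  congr 1
  ext ⟨i, j⟩
  simp only [Finset.mem_filter, Finset.mem_product, Finset.mem_range]
  constructor
  · exact fun h => ⟨T.mem_cells_of_mem_entry h.2, h.2⟩
  · exact fun h => ⟨lt_of_mem_cells h.1, h.2⟩

theorem range_split {n b : ℕ} (hb : b < n) :
    ∃ r, List.range n = List.range b ++ b :: r ∧ ∀ k ∈ r, b < k := by
  refine ⟨(List.range (n - b - 1)).map fun k => b + 1 + k, ?_, ?_⟩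
  · conv_lhs => rw [show n = b + 1 + (n - b - 1) by omega, List.range_add, List.range_succ]
    simp
  · simp only [List.mem_map]
    rintro k ⟨m, -, rfl⟩
    omega

theorem word_split (T : SVT cells) {a b : ℕ} (hab : (a, b) ∈ cells) :
    ∃ below rest, T.word =
        ((List.range b).flatMap (T.colWord ((cells.sup fun c => max c.1 c.2) + 1))) ++
          (below ++ ((T.entry (a, b)).sort (· ≤ ·) ++ rest)) ∧
      (∀ y ∈ below, ∃ i, a < i ∧ y ∈ T.entry (i, b)) ∧
      (∀ y ∈ rest, ∃ i j, (b < j ∨ j = b ∧ i < a) ∧ y ∈ T.entry (i, j)) := by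
  obtain ⟨ha, hb⟩ := lt_of_mem_cells hab
  obtain ⟨r, hr, hr'⟩ := range_split ha
  obtain ⟨s, hs, hs'⟩ := range_split hb
  refine ⟨r.reverse.flatMap fun i => (T.entry (i, b)).sort (· ≤ ·),
    ((List.range a).reverse.flatMap fun i => (T.entry (i, b)).sort (· ≤ ·)) ++
      s.flatMap (T.colWord ((cells.sup fun c => max c.1 c.2) + 1)), ?_, ?_, ?_⟩
  · change (List.range _).flatMap (T.colWord _) = _
    conv_lhs => rw [hs]
    rw [List.flatMap_append, List.flatMap_cons]
    congr 1
    conv_lhs => lhs; rw [colWord, hr]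
    simp
  · intro y hy
    simp only [List.mem_flatMap, List.mem_reverse, Finset.mem_sort] at hy
    obtain ⟨i, hi, hy⟩ := hy
    exact ⟨i, hr' i hi, hy⟩
  · intro y hy
    simp only [colWord, List.mem_append, List.mem_flatMap, List.mem_reverse, Finset.mem_sort,
      List.mem_range] at hy
    rcases hy with ⟨i, hi, hy⟩ | ⟨j, hj, i, -, hy⟩
    · exact ⟨i, b, Or.inr ⟨rfl, hi⟩, hy⟩
    · exact ⟨i, j, Or.inl (hs' j hj), hy⟩

theorem sort_split {s : Finset ℕ} {x : ℕ} (hx : x ∈ s) :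
    ∃ u v, s.sort (· ≤ ·) = u ++ x :: v ∧ (∀ y ∈ u, y < x) ∧ (∀ y ∈ v, x < y) := by
  obtain ⟨u, v, h⟩ := List.append_of_mem ((Finset.mem_sort (· ≤ ·)).2 hx)
  have hs : (s.sort (· ≤ ·)).Pairwise (· < ·) := s.sortedLT_sort.pairwise
  rw [h, List.pairwise_append, List.pairwise_cons] at hs
  exact ⟨u, v, h, fun y hy => hs.2.2 y hy x (by simp), hs.2.1.1⟩

/-- In a tableau with reverse lattice word, each entry `x + 1` is preceded, in the reversed reading
order, by an entry `x`. -/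
theorem exists_entry_after (T : SVT cells) (hT : IsRLW T.word) {a b x : ℕ}
    (hx : x + 1 ∈ T.entry (a, b)) :
    ∃ i j, (b < j ∨ j = b ∧ i < a) ∧ x ∈ T.entry (i, j) := by
  obtain ⟨below, rest, hw, -, hr⟩ := T.word_split (T.mem_cells_of_mem_entry hx)
  obtain ⟨u, v, hs, -, hv⟩ := sort_split hx
  have hsuf : ((x + 1) :: v ++ rest) <:+ T.word := by
    rw [hw, hs]
    exact ⟨(List.range b).flatMap (T.colWord ((cells.sup fun c => max c.1 c.2) + 1)) ++ below ++ u, by simp⟩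
  have hcount := hT _ hsuf x
  have hmem : x ∈ (x + 1) :: v ++ rest := by
    rw [← List.count_pos_iff]
    refine lt_of_lt_of_le ?_ hcount
    simp
  simp only [List.cons_append, List.mem_cons, List.mem_append] at hmem
  rcases hmem with h | h | h
  · omega
  · have := hv x h
    omega
  · exact hr x h

/-- In a tableau with reverse lattice word containing equally many `x` and `x + 1`, an entry `x` is
followed by an entry `x + 1` below it, provided no earlier column has more `x + 1` than `x`. -/
theorem exists_entry_below (T : SVT cells) (hT : IsRLW T.word) {a b x : ℕ}
    (hx : x ∈ T.entry (a, b)) (heq : T.word.count (x + 1) = T.word.count x)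
    (hcol : ∀ j < b, ∀ n, (∀ c ∈ cells, c.1 < n) →
      (T.colWord n j).count (x + 1) ≤ (T.colWord n j).count x) :
    ∃ i, a < i ∧ x + 1 ∈ T.entry (i, b) := by
  obtain ⟨below, rest, hw, hb, -⟩ := T.word_split (T.mem_cells_of_mem_entry hx)
  obtain ⟨u, v, hs, hu, -⟩ := sort_split hx
  have hcount := hT (v ++ rest) (by
    rw [hw, hs]
    exact ⟨(List.range b).flatMap (T.colWord ((cells.sup fun c => max c.1 c.2) + 1)) ++ below ++ u ++ [x], by simp⟩) x
  by_contra hne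
  have h1 : below.count (x + 1) = 0 := List.count_eq_zero.2 fun h => hne (hb _ h)
  have h2 : u.count (x + 1) = 0 := List.count_eq_zero.2 fun h => by
    have := hu _ h
    omega
  have h3 : ((List.range b).flatMap
      (T.colWord ((cells.sup fun c => max c.1 c.2) + 1))).count (x + 1) ≤
      ((List.range b).flatMap (T.colWord ((cells.sup fun c => max c.1 c.2) + 1))).count x := by
    rw [List.count_flatMap, List.count_flatMap]
    refine List.sum_le_sum fun j hj => hcol j (List.mem_range.1 hj) _ fun c hc => ?_
    exact (lt_of_mem_cells hc).1
  rw [hw, hs] at heq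
  simp only [List.count_append, List.count_cons_self,
    List.count_cons_of_ne (show x ≠ x + 1 by omega)] at heq hcount
  omega

end SVT

section Star

variable {lam mu : YoungDiagram}

theorem mem_starCells {i j : ℕ} : (i, j) ∈ starCells lam mu ↔
    (mu.rowLen 0 ≤ j ∧ (i, j - mu.rowLen 0) ∈ lam) ∨
      (lam.colLen 0 ≤ i ∧ (i - lam.colLen 0, j) ∈ mu) := by
  simp only [starCells, Finset.mem_union, Finset.mem_image, Prod.mk.injEq, Prod.exists,
    YoungDiagram.mem_cells]
  refine or_congr ⟨?_, ?_⟩ ⟨?_, ?_⟩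
  · rintro ⟨a, b, h, rfl, rfl⟩
    simpa using h
  · rintro ⟨h, h'⟩
    exact ⟨_, _, h', rfl, by omega⟩
  · rintro ⟨a, b, h, rfl, rfl⟩
    simpa using h
  · rintro ⟨h, h'⟩
    exact ⟨_, _, h', by omega, rfl⟩

theorem lam_mem_starCells {i j : ℕ} (h : (i, j) ∈ lam) :
    (i, j + mu.rowLen 0) ∈ starCells lam mu :=
  mem_starCells.2 (Or.inl ⟨by omega, by simpa using h⟩)

theorem mu_mem_starCells {i j : ℕ} (h : (i, j) ∈ mu) :
    (i + lam.colLen 0, j) ∈ starCells lam mu :=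
  mem_starCells.2 (Or.inr ⟨by omega, by simpa using h⟩)

theorem YoungDiagram.lt_rowLen_zero {i j : ℕ} (h : (i, j) ∈ mu) : j < mu.rowLen 0 :=
  YoungDiagram.mem_iff_lt_rowLen.1 (mu.up_left_mem (Nat.zero_le i) le_rfl h)

theorem mem_lam_of_mem_starCells {i j : ℕ} (h : (i, j) ∈ starCells lam mu)
    (hj : mu.rowLen 0 ≤ j) : (i, j - mu.rowLen 0) ∈ lam := by
  rcases mem_starCells.1 h with h | h
  · exact h.2
  · have := YoungDiagram.lt_rowLen_zero h.2
    omega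

theorem mem_mu_of_mem_starCells {i j : ℕ} (h : (i, j) ∈ starCells lam mu)
    (hj : j < mu.rowLen 0) : lam.colLen 0 ≤ i ∧ (i - lam.colLen 0, j) ∈ mu := by
  rcases mem_starCells.1 h with h | h
  · omega
  · exact h

/-- In a tableau of shape `λ * μ` with reverse lattice word, row `i` of `λ` is filled with `i`. -/
theorem SVT.eq_of_mem_entry_lam (T : SVT (starCells lam mu)) (hT : IsRLW T.word) (i : ℕ) :
    ∀ j, (i, j) ∈ lam → ∀ x ∈ T.entry (i, j + mu.rowLen 0), x = i := by
  induction i using Nat.strong_induction_on with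
  | _ i ih =>
  have lower : ∀ j, (i, j) ∈ lam → ∀ x ∈ T.entry (i, j + mu.rowLen 0), i ≤ x := by
    intro j hj x hx
    rcases i with _ | i
    · omega
    · have hup : (i, j) ∈ lam := lam.up_left_mem (Nat.le_succ i) le_rfl hj
      obtain ⟨y, hy⟩ := T.nonempty_of_mem _ (lam_mem_starCells (mu := mu) hup)
      have h1 := ih i (Nat.lt_succ_self i) j hup y hy
      have h2 := T.col_strict _ _ (lam_mem_starCells hup) (lam_mem_starCells hj) y hy x hx
      omega
  have key : ∀ k j, j + k + 1 = lam.rowLen i →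
      ∀ x ∈ T.entry (i, j + mu.rowLen 0), x = i := by
    intro k
    induction k with
    | zero =>
      intro j hj x hx
      have hmem : (i, j) ∈ lam := YoungDiagram.mem_iff_lt_rowLen.2 (by omega)
      have hle := lower j hmem x hx
      by_contra hne
      obtain ⟨y, rfl⟩ : ∃ y, x = y + 1 := ⟨x - 1, by omega⟩
      obtain ⟨i', j', hafter, hy⟩ := T.exists_entry_after hT hx
      have hj' : mu.rowLen 0 ≤ j' := by omega
      have hmem' := mem_lam_of_mem_starCells (T.mem_cells_of_mem_entry hy) hj'
      have hi' : i' < i := by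
        by_contra hge
        have := YoungDiagram.mem_iff_lt_rowLen.1
          (lam.up_left_mem (not_lt.1 hge) le_rfl hmem')
        omega
      have := ih i' hi' _ hmem' y (by rwa [Nat.sub_add_cancel hj'])
      omega
    | succ k ihk =>
      intro j hj x hx
      have hmem : (i, j) ∈ lam := YoungDiagram.mem_iff_lt_rowLen.2 (by omega)
      have hmem' : (i, j + 1) ∈ lam := YoungDiagram.mem_iff_lt_rowLen.2 (by omega)
      have hle := lower j hmem x hx
      have hcell : (i, j + mu.rowLen 0 + 1) ∈ starCells lam mu := by
        rw [Nat.add_right_comm]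
        exact lam_mem_starCells hmem'
      obtain ⟨y, hy⟩ := T.nonempty_of_mem _ hcell
      have h1 := T.row_weak _ _ (lam_mem_starCells hmem) hcell x hx y hy
      have h2 := ihk (j + 1) (by omega) y (by rwa [Nat.add_right_comm])
      omega
  intro j hj
  have := YoungDiagram.mem_iff_lt_rowLen.1 hj
  exact key (lam.rowLen i - j - 1) j (by omega)

/-- In a tableau of shape `λ * μ` whose word is a reverse lattice word of rectangular content with
`p` rows, column `j` of `μ` is filled with consecutive integers ending at `p - 1`. -/
theorem SVT.add_colLen_eq_of_mem_entry_mu (T : SVT (starCells lam mu)) (hT : IsRLW T.word) {p : ℕ}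
    (hcount : ∀ y, y + 1 < p → T.word.count (y + 1) = T.word.count y)
    (hlt : ∀ c, ∀ x ∈ T.entry c, x < p) (j : ℕ) :
    ∀ i, (i, j) ∈ mu → ∀ x ∈ T.entry (i + lam.colLen 0, j), x + mu.colLen j = p + i := by
  induction j using Nat.strong_induction_on with
  | _ j ih =>
  suffices key : ∀ k i, i + k + 1 = mu.colLen j →
      ∀ x ∈ T.entry (i + lam.colLen 0, j), x + mu.colLen j = p + i by
    intro i hi
    have := YoungDiagram.mem_iff_lt_colLen.1 hi
    exact key (mu.colLen j - i - 1) i (by omega)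
  intro k
  induction k using Nat.strong_induction_on with
  | _ k ihk =>
  intro i hi x hx
  have hmem : (i, j) ∈ mu := YoungDiagram.mem_iff_lt_colLen.2 (by omega)
  have hupper : x + mu.colLen j ≤ p + i := by
    rcases k with _ | k
    · have := hlt _ x hx
      omega
    · have hmem' : (i + 1, j) ∈ mu := YoungDiagram.mem_iff_lt_colLen.2 (by omega)
      have hcell : (i + lam.colLen 0 + 1, j) ∈ starCells lam mu := by
        rw [Nat.add_right_comm]
        exact mu_mem_starCells hmem'
      obtain ⟨y, hy⟩ := T.nonempty_of_mem _ hcell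
      have h1 := T.col_strict _ _ (mu_mem_starCells hmem) hcell x hx y hy
      have h2 := ihk k (Nat.lt_succ_self k) (i + 1) (by omega) y (by rwa [Nat.add_right_comm])
      omega
  by_contra hne
  have hprev : ∀ j' < j, p ≤ x + mu.colLen j' := by
    intro j' hj'
    obtain ⟨m, rfl⟩ : ∃ m, j = m + 1 := ⟨j - 1, by omega⟩
    have hmem' : (i, m) ∈ mu := mu.up_left_mem le_rfl (Nat.le_succ m) hmem
    obtain ⟨y, hy⟩ := T.nonempty_of_mem _ (mu_mem_starCells (lam := lam) hmem')
    have h1 := T.row_weak _ _ (mu_mem_starCells hmem') (mu_mem_starCells hmem) y hy x hx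
    have h2 := ih m (Nat.lt_succ_self m) i hmem' y hy
    have h3 := mu.colLen_anti j' m (by omega)
    omega
  have hj0 := YoungDiagram.lt_rowLen_zero hmem
  obtain ⟨i', hii', hi'⟩ := T.exists_entry_below hT hx (hcount x (by omega)) (by
    intro j' hj' n hn
    rw [T.count_colWord, T.count_colWord]
    refine le_trans (Finset.card_le_one.2 ?_) (Finset.card_pos.2 ?_)
    · intro a ha b hb
      simp only [Finset.mem_filter] at ha hb
      obtain ⟨ha1, ha2⟩ :=
        mem_mu_of_mem_starCells (T.mem_cells_of_mem_entry ha.2) (hj'.trans hj0)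
      obtain ⟨hb1, hb2⟩ :=
        mem_mu_of_mem_starCells (T.mem_cells_of_mem_entry hb.2) (hj'.trans hj0)
      have h1 := ih j' hj' _ ha2 _ (by rw [Nat.sub_add_cancel ha1]; exact ha.2)
      have h2 := ih j' hj' _ hb2 _ (by rw [Nat.sub_add_cancel hb1]; exact hb.2)
      omega
    · have h1 := hprev j' hj'
      have h2 := hlt _ x hx
      have hmem' : (x + mu.colLen j' - p, j') ∈ mu :=
        YoungDiagram.mem_iff_lt_colLen.2 (by omega)
      have hcell := mu_mem_starCells (lam := lam) hmem'
      obtain ⟨y, hy⟩ := T.nonempty_of_mem _ hcell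
      have h3 := ih j' hj' _ hmem' y hy
      obtain rfl : y = x := by omega
      exact ⟨_, Finset.mem_filter.2 ⟨Finset.mem_range.2 (hn _ hcell), hy⟩⟩)
  obtain ⟨h1, h2⟩ := mem_mu_of_mem_starCells (T.mem_cells_of_mem_entry hi') hj0
  have h3 := YoungDiagram.mem_iff_lt_colLen.1 h2
  have h4 := ihk (mu.colLen j - (i' - lam.colLen 0) - 1) (by omega) (i' - lam.colLen 0) (by omega) (x + 1)
    (by rwa [Nat.sub_add_cancel h1])
  omega

theorem rowLen_rect (p q i : ℕ) : (rect p q).rowLen i = if i < p then q else 0 := by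
  have h : ∀ j, j < (rect p q).rowLen i ↔ i < p ∧ j < q := fun j => by
    rw [← YoungDiagram.mem_iff_lt_rowLen, ← YoungDiagram.mem_cells]
    simp [rect]
  split_ifs with hi
  · have h1 := h q
    have h2 := h ((rect p q).rowLen i)
    omega
  · have h1 := h 0
    omega

theorem colLen_zero_le_of_le_rect {p q : ℕ} (hmu : mu ≤ rect p q) : mu.colLen 0 ≤ p := by
  by_contra hlt
  have h : (p, 0) ∈ (rect p q).cells := hmu (YoungDiagram.mem_iff_lt_colLen.2 (not_le.1 hlt))
  simp [rect] at h

namespace SVT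

variable {p q : ℕ}

theorem count_word_of_hasContent_rect {T : SVT (starCells lam mu)}
    (hc : HasContent T.word (rect p q)) (y : ℕ) : T.word.count y = if y < p then q else 0 := by
  rw [hc y, rowLen_rect]

theorem lt_of_mem_entry_of_hasContent_rect {T : SVT (starCells lam mu)}
    (hc : HasContent T.word (rect p q)) (c : ℕ × ℕ) (x : ℕ) (hx : x ∈ T.entry c) : x < p := by
  by_contra hlt
  have h := count_word_of_hasContent_rect hc x
  rw [if_neg hlt, count_word_s19, Finset.card_eq_zero, Finset.filter_eq_empty_iff] at h
  exact h (T.mem_cells_of_mem_entry hx) hx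

theorem add_colLen_eq_of_hasContent_rect {T : SVT (starCells lam mu)}
    (hT : IsRLW T.word) (hc : HasContent T.word (rect p q)) {i j x : ℕ} (hij : (i, j) ∈ mu)
    (hx : x ∈ T.entry (i + lam.colLen 0, j)) : x + mu.colLen j = p + i := by
  refine T.add_colLen_eq_of_mem_entry_mu hT (fun y hy => ?_)
    (lt_of_mem_entry_of_hasContent_rect hc) j i hij x hx
  rw [count_word_of_hasContent_rect hc, count_word_of_hasContent_rect hc, if_pos hy,
    if_pos (by omega)]

theorem subsingleton_rect :
    Subsingleton {T : SVT (starCells lam mu) // IsRLW T.word ∧ HasContent T.word (rect p q)} := by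
  have key : ∀ T T' : SVT (starCells lam mu), IsRLW T.word → IsRLW T'.word →
      HasContent T.word (rect p q) → HasContent T'.word (rect p q) →
      ∀ c, T.entry c ⊆ T'.entry c := by
    rintro T T' hT hT' hc hc' ⟨i, j⟩ x hx
    have hcell := T.mem_cells_of_mem_entry hx
    obtain ⟨y, hy⟩ := T'.nonempty_of_mem _ hcell
    suffices x = y from this ▸ hy
    rcases Nat.lt_or_ge j (mu.rowLen 0) with hj | hj
    · obtain ⟨h1, h2⟩ := mem_mu_of_mem_starCells hcell hj
      rw [← Nat.sub_add_cancel h1] at hx hy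
      have h3 := add_colLen_eq_of_hasContent_rect hT hc h2 hx
      have h4 := add_colLen_eq_of_hasContent_rect hT' hc' h2 hy
      omega
    · have h := mem_lam_of_mem_starCells hcell hj
      rw [← Nat.sub_add_cancel hj] at hx hy
      rw [T.eq_of_mem_entry_lam hT i _ h x hx, T'.eq_of_mem_entry_lam hT' i _ h y hy]
  refine ⟨fun ⟨T, hT, hc⟩ ⟨T', hT', hc'⟩ => Subtype.ext ?_⟩
  have h : T.entry = T'.entry := funext fun c =>
    (key T T' hT hT' hc hc' c).antisymm (key T' T hT' hT hc' hc c)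
  change T = T'
  cases T
  cases T'
  cases h
  rfl

theorem rowLen_add_rowLen_eq (hmu : mu ≤ rect p q) {T : SVT (starCells lam mu)}
    (hT : IsRLW T.word) (hc : HasContent T.word (rect p q)) {y : ℕ} (hy : y < p) :
    lam.rowLen y + mu.rowLen (p - 1 - y) = q := by
  have hcount := count_word_of_hasContent_rect hc y
  rw [if_pos hy, count_word_s19] at hcount
  have hp := colLen_zero_le_of_le_rect hmu
  have hle := mu.rowLen_anti 0 (p - 1 - y) (Nat.zero_le _)
  have himage : ((starCells lam mu).filter fun c => y ∈ T.entry c).image Prod.snd =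
      Finset.range (mu.rowLen (p - 1 - y)) ∪
        Finset.Ico (mu.rowLen 0) (mu.rowLen 0 + lam.rowLen y) := by
    ext j
    simp only [Finset.mem_image, Finset.mem_filter, Prod.exists, exists_eq_right,
      Finset.mem_union, Finset.mem_range, Finset.mem_Ico]
    have hcol := mu.colLen_anti 0 j (Nat.zero_le j)
    constructor
    · rintro ⟨i, hcell, hx⟩
      rcases Nat.lt_or_ge j (mu.rowLen 0) with hj | hj
      · obtain ⟨h1, h2⟩ := mem_mu_of_mem_starCells hcell hj
        rw [← Nat.sub_add_cancel h1] at hx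
        have h3 := add_colLen_eq_of_hasContent_rect hT hc h2 hx
        refine Or.inl (YoungDiagram.mem_iff_lt_rowLen.1 (YoungDiagram.mem_iff_lt_colLen.2 ?_))
        omega
      · have h := mem_lam_of_mem_starCells hcell hj
        rw [← Nat.sub_add_cancel hj] at hx
        obtain rfl := T.eq_of_mem_entry_lam hT i _ h y hx
        have := YoungDiagram.mem_iff_lt_rowLen.1 h
        omega
    · rintro (hj | ⟨hj, hj'⟩)
      · have h1 := YoungDiagram.mem_iff_lt_colLen.1 (YoungDiagram.mem_iff_lt_rowLen.2 hj)
        have h2 : (y + mu.colLen j - p, j) ∈ mu := YoungDiagram.mem_iff_lt_colLen.2 (by omega)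
        have hcell := mu_mem_starCells (lam := lam) h2
        obtain ⟨x, hx⟩ := T.nonempty_of_mem _ hcell
        have h3 := add_colLen_eq_of_hasContent_rect hT hc h2 hx
        obtain rfl : x = y := by omega
        exact ⟨_, hcell, hx⟩
      · have h : (y, j - mu.rowLen 0) ∈ lam := YoungDiagram.mem_iff_lt_rowLen.2 (by omega)
        have hcell := lam_mem_starCells (mu := mu) h
        obtain ⟨x, hx⟩ := T.nonempty_of_mem _ hcell
        obtain rfl := T.eq_of_mem_entry_lam hT _ _ h x hx
        rw [Nat.sub_add_cancel hj] at hcell hx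
        exact ⟨_, hcell, hx⟩
  have hinj : Set.InjOn Prod.snd
      (((starCells lam mu).filter fun c => y ∈ T.entry c : Finset (ℕ × ℕ)) : Set (ℕ × ℕ)) := by
    rintro ⟨i, j⟩ hi ⟨i', j'⟩ hi' (rfl : j = j')
    simp only [Finset.coe_filter, Set.mem_ofPred_eq] at hi hi'
    obtain ⟨hcell, hx⟩ := hi
    obtain ⟨hcell', hx'⟩ := hi'
    suffices i = i' from this ▸ rfl
    rcases Nat.lt_or_ge j (mu.rowLen 0) with hj | hj
    · obtain ⟨h1, h2⟩ := mem_mu_of_mem_starCells hcell hj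
      obtain ⟨h1', h2'⟩ := mem_mu_of_mem_starCells hcell' hj
      rw [← Nat.sub_add_cancel h1] at hx
      rw [← Nat.sub_add_cancel h1'] at hx'
      have h3 := add_colLen_eq_of_hasContent_rect hT hc h2 hx
      have h4 := add_colLen_eq_of_hasContent_rect hT hc h2' hx'
      omega
    · have h := mem_lam_of_mem_starCells hcell hj
      have h' := mem_lam_of_mem_starCells hcell' hj
      rw [← Nat.sub_add_cancel hj] at hx hx'
      rw [← T.eq_of_mem_entry_lam hT i _ h y hx, ← T.eq_of_mem_entry_lam hT i' _ h' y hx']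
  rw [← Finset.card_image_of_injOn hinj, himage, Finset.card_union_of_disjoint,
    Finset.card_range, Nat.card_Ico] at hcount
  · omega
  · rw [Finset.disjoint_left]
    intro j
    simp only [Finset.mem_range, Finset.mem_Ico]
    omega

theorem fst_lt_of_mem_lam {T : SVT (starCells lam mu)} (hT : IsRLW T.word)
    (hc : HasContent T.word (rect p q)) {i j : ℕ} (hij : (i, j) ∈ lam) : i < p := by
  obtain ⟨x, hx⟩ := T.nonempty_of_mem _ (lam_mem_starCells (mu := mu) hij)
  rw [← T.eq_of_mem_entry_lam hT i j hij x hx]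
  exact lt_of_mem_entry_of_hasContent_rect hc _ x hx

end SVT

theorem card_muHat {p q : ℕ} (hmu : mu ≤ rect p q) : (muHat p q mu).card = mu.card := by
  refine Finset.card_nbij' (fun c => (p - 1 - c.1, q - 1 - c.2))
    (fun c => (p - 1 - c.1, q - 1 - c.2)) ?_ ?_ ?_ ?_
  · rintro ⟨i, j⟩ h
    simp only [muHat, Finset.coe_filter, Finset.mem_product, Finset.mem_range,
      Set.mem_ofPred_eq] at h
    simp only [Finset.mem_coe, YoungDiagram.mem_cells, YoungDiagram.mem_iff_lt_rowLen]
    omega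
  · rintro ⟨i, j⟩ h
    have hr := hmu h
    simp only [rect, ← YoungDiagram.mem_cells,
      Finset.mem_product, Finset.mem_range] at hr
    simp only [Finset.mem_coe, YoungDiagram.mem_cells, YoungDiagram.mem_iff_lt_rowLen] at h
    simp only [muHat, Finset.coe_filter, Finset.mem_product, Finset.mem_range,
      Set.mem_ofPred_eq]
    rw [show p - 1 - (p - 1 - i) = i by omega]
    omega
  · rintro ⟨i, j⟩ h
    simp only [muHat, Finset.coe_filter, Finset.mem_product, Finset.mem_range,
      Set.mem_ofPred_eq] at h
    simp only [Prod.mk.injEq]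
    omega
  · rintro ⟨i, j⟩ h
    have hr := hmu h
    simp only [rect, ← YoungDiagram.mem_cells,
      Finset.mem_product, Finset.mem_range] at hr
    simp only [Prod.mk.injEq]
    omega

end Star

/-- **Rectangular structure constants** (Section 7): if `R` is the `p × q`
rectangle, `μ ⊆ R`, and `c^R_{λμ} ≠ 0`, then `R` is the disjoint union of `λ`
and `μ̂` (in particular `|λ| + |μ| = pq`) and `c^R_{λμ} = 1`. -/
theorem cLR_rectangle (p q : ℕ) (hp : 1 ≤ p) (hq : 1 ≤ q) (lam mu : YoungDiagram)
    (hmu : mu ≤ rect p q) (h : cLR lam mu (rect p q) ≠ 0) :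
    lam ≤ rect p q ∧ lam.cells ∩ muHat p q mu = ∅ ∧
      lam.cells ∪ muHat p q mu = (rect p q).cells ∧
      lam.card + mu.card = p * q ∧ cLR lam mu (rect p q) = 1 := by
  have hcard : Nat.card {T : SVT (starCells lam mu) //
      IsRLW T.word ∧ HasContent T.word (rect p q)} ≠ 0 := by
    intro h0
    simp [cLR, h0] at h
  obtain ⟨⟨T, hT, hc⟩⟩ := (Nat.card_ne_zero.1 hcard).1
  have hone := (Nat.card_eq_one_iff_unique (α := {T : SVT (starCells lam mu) //
      IsRLW T.word ∧ HasContent T.word (rect p q)})).2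
    ⟨SVT.subsingleton_rect, ⟨T, hT, hc⟩⟩
  have hinter : lam.cells ∩ muHat p q mu = ∅ := by
    ext ⟨i, j⟩
    simp only [muHat, Finset.mem_inter, Finset.mem_filter, Finset.mem_product, Finset.mem_range,
      YoungDiagram.mem_cells, YoungDiagram.mem_iff_lt_rowLen, Finset.notMem_empty, iff_false]
    rintro ⟨h1, ⟨hi, -⟩, h2⟩
    have := SVT.rowLen_add_rowLen_eq hmu hT hc hi
    omega
  have hunion : lam.cells ∪ muHat p q mu = (rect p q).cells := by
    ext ⟨i, j⟩
    simp only [muHat, rect, Finset.mem_union, Finset.mem_filter, Finset.mem_product,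
      Finset.mem_range, YoungDiagram.mem_cells]
    constructor
    · rintro (h1 | ⟨h1, -⟩)
      · have hi := SVT.fst_lt_of_mem_lam hT hc h1
        have := SVT.rowLen_add_rowLen_eq hmu hT hc hi
        rw [YoungDiagram.mem_iff_lt_rowLen] at h1
        omega
      · exact h1
    · rintro ⟨hi, hj⟩
      have := SVT.rowLen_add_rowLen_eq hmu hT hc hi
      rw [YoungDiagram.mem_iff_lt_rowLen]
      omega
  have hrect : (rect p q).card = p * q := by
    simp [rect, YoungDiagram.card]
  have hsum : lam.card + mu.card = p * q := by
    rw [← hrect, ← card_muHat hmu, YoungDiagram.card, YoungDiagram.card, ← hunion,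
      Finset.card_union_of_disjoint (Finset.disjoint_iff_inter_eq_empty.2 hinter)]
  refine ⟨?_, hinter, hunion, hsum, ?_⟩
  · change lam.cells ⊆ (rect p q).cells
    rw [← hunion]
    exact Finset.subset_union_left
  · rw [cLR, hone, hrect, show p * q - lam.card - mu.card = 0 by omega]
    simp
end
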